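/- Let I be a squarefree monomial ideal of S. Then I is a Cartwright-Sturmfels ideal if and only if its Alexander dual I* is a Cartwright-Sturmfels* ideal. Moreover, if I is a Cartwright-Sturmfels ideal, then gin(I)* = pol(gin(I*)), i.e. the Alexander dual of the generic initial ideal of I equals the polarization of the generic initial ideal of I*. -/

import Mathlib

open MvPolynomial

noncomputable section

namespace CSPaper

/-- The set of variables of the standard `ℤ^v`-graded polynomial ring `S`:
the variable `x_{i j}` of the paper (with `1 ≤ i ≤ v`, `1 ≤ j ≤ n_i`) corresponds to
`⟨i-1, j-1⟩ : MVar v n` where `n (i-1) = n_i - 1`; thus row `i` has `n i + 1 > 0`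
variables and the first variable `x_{i 1}` of row `i` corresponds to `⟨i, 0⟩`. -/
abbrev MVar (v : ℕ) (n : Fin v → ℕ) : Type := Σ i : Fin v, Fin (n i + 1)

/-- The weight function giving the standard `ℤ^v`-grading: `deg (x_{i j}) = e_i ∈ ℤ^v`. -/
def wt (v : ℕ) (n : Fin v → ℕ) : MVar v n → (Fin v → ℕ) := fun p => Pi.single p.1 1

variable {K : Type} [Field K] {v : ℕ} {n : Fin v → ℕ}

/-- An ideal of `S` is `ℤ^v`-graded (multigraded) iff it contains every multihomogeneous
component of each of its elements. -/
def IsMultigraded (I : Ideal (MvPolynomial (MVar v n) K)) : Prop :=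
  ∀ f ∈ I, ∀ a : Fin v → ℕ, weightedHomogeneousComponent (wt v n) a f ∈ I

/-- The value of the `ℤ^v`-graded Hilbert function of the ideal `I` at `a ∈ ℕ^v`:
`dim_K I_a`. -/
def hilb (I : Ideal (MvPolynomial (MVar v n) K)) (a : Fin v → ℕ) : ℕ :=
  Module.finrank K
    ((Submodule.restrictScalars K I ⊓ weightedHomogeneousSubmodule K (wt v n) a :
      Submodule K (MvPolynomial (MVar v n) K)))

/-- Two ideals have the same `ℤ^v`-graded Hilbert series. -/
def sameHS (I J : Ideal (MvPolynomial (MVar v n) K)) : Prop :=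
  ∀ a : Fin v → ℕ, hilb I a = hilb J a

/-- The `ℤ^v`-graded `K`-algebra endomorphism of `S` determined by a `v`-tuple of square
matrices: `x_{i j} ↦ ∑_k (g i)_{k j} x_{i k}`.  For invertible `g i` these are exactly the
elements of `G = GL_{n_1}(K) × ⋯ × GL_{n_v}(K)` acting on `S`. -/
def gAct (g : ∀ i : Fin v, Matrix (Fin (n i + 1)) (Fin (n i + 1)) K) :
    MvPolynomial (MVar v n) K →ₐ[K] MvPolynomial (MVar v n) K :=
  aeval fun p : MVar v n => ∑ k : Fin (n p.1 + 1), C (g p.1 k p.2) * X ⟨p.1, k⟩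

/-- A property `P` of `v`-tuples of matrices holds generically (i.e. for a general
`g ∈ GL_{n_1}(K) × ⋯ × GL_{n_v}(K)`) if there is a nonzero polynomial `h` in the matrix
entries such that `P g` holds for every invertible `g` with `h(g) ≠ 0`. -/
def Generically
    (P : (∀ i : Fin v, Matrix (Fin (n i + 1)) (Fin (n i + 1)) K) → Prop) : Prop :=
  ∃ h : MvPolynomial (Σ i : Fin v, Fin (n i + 1) × Fin (n i + 1)) K, h ≠ 0 ∧
    ∀ g : ∀ i : Fin v, Matrix (Fin (n i + 1)) (Fin (n i + 1)) K,
      (∀ i, IsUnit (g i).det) →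
      eval (fun q : Σ i : Fin v, Fin (n i + 1) × Fin (n i + 1) => g q.1 q.2.1 q.2.2) h ≠ 0 →
      P g

/-- The leading exponent (exponent of the leading monomial) of a polynomial with respect to
a term order `τ` (a `MonomialOrder`); by convention `leadExp τ 0 = 0`. -/
def leadExp (τ : MonomialOrder (MVar v n)) (f : MvPolynomial (MVar v n) K) :
    MVar v n →₀ ℕ :=
  τ.toSyn.symm (f.support.sup τ.toSyn)

/-- The initial ideal `in_τ(I)`: the monomial ideal generated by the leading monomials of the
nonzero elements of `I`. -/
def inIdeal (τ : MonomialOrder (MVar v n)) (I : Ideal (MvPolynomial (MVar v n) K)) :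
    Ideal (MvPolynomial (MVar v n) K) :=
  Ideal.span {m | ∃ f ∈ I, f ≠ 0 ∧ m = monomial (leadExp τ f) (1 : K)}

/-- `G` is a Gröbner basis of `I` with respect to the term order `τ`. -/
def IsGroebnerBasis (τ : MonomialOrder (MVar v n)) (G : Set (MvPolynomial (MVar v n) K))
    (I : Ideal (MvPolynomial (MVar v n) K)) : Prop :=
  G ⊆ (I : Set (MvPolynomial (MVar v n) K)) ∧
    Ideal.span ((fun f => monomial (leadExp τ f) (1 : K)) '' {f ∈ G | f ≠ 0}) = inIdeal τ I

/-- `J = gin_τ(I)`, the `ℤ^v`-graded generic initial ideal: for a general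
`g ∈ GL_{n_1}(K) × ⋯ × GL_{n_v}(K)` one has `in_τ(g(I)) = J`. -/
def IsGin (τ : MonomialOrder (MVar v n)) (I J : Ideal (MvPolynomial (MVar v n) K)) : Prop :=
  Generically fun g => inIdeal τ (Ideal.map (gAct g) I) = J

/-- A term order such that `x_{i j} > x_{i k}` whenever `j < k`. -/
def RespectsVarOrder (τ : MonomialOrder (MVar v n)) : Prop :=
  ∀ (i : Fin v) (j k : Fin (n i + 1)), j < k →
    τ.toSyn (Finsupp.single (⟨i, k⟩ : MVar v n) 1) <
      τ.toSyn (Finsupp.single (⟨i, j⟩ : MVar v n) 1)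

/-- An ideal is Borel fixed if it is fixed by every element of the Borel subgroup
`B = B_{n_1}(K) × ⋯ × B_{n_v}(K)` of upper triangular invertible matrices (upper triangular
with respect to the order `x_{i 1} > x_{i 2} > ⋯` of the variables in each row). -/
def BorelFixed (I : Ideal (MvPolynomial (MVar v n) K)) : Prop :=
  ∀ g : ∀ i : Fin v, Matrix (Fin (n i + 1)) (Fin (n i + 1)) K,
    (∀ i, IsUnit (g i).det) →
    (∀ (i : Fin v) (k j : Fin (n i + 1)), j < k → g i k j = 0) →
    Ideal.map (gAct g) I = I

/-- A Cartwright-Sturmfels ideal: a `ℤ^v`-graded ideal with the same `ℤ^v`-graded Hilbert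
series as some radical Borel fixed ideal. -/
def IsCS (I : Ideal (MvPolynomial (MVar v n) K)) : Prop :=
  IsMultigraded I ∧ ∃ J : Ideal (MvPolynomial (MVar v n) K),
    J.IsRadical ∧ BorelFixed J ∧ sameHS I J

/-- The exponent of the monomial `x_{1 1}^{a 1} ⋯ x_{v 1}^{a v}` of
`T = K[x_{1 1}, …, x_{v 1}] ⊆ S`. -/
def Tmono (v : ℕ) (n : Fin v → ℕ) (a : Fin v → ℕ) : MVar v n →₀ ℕ :=
  ∑ i : Fin v, Finsupp.single (⟨i, 0⟩ : MVar v n) (a i)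

/-- A `ℤ^v`-graded ideal of `S` extended from `T`, i.e. generated by monomials in the
variables `x_{1 1}, …, x_{v 1}`. -/
def ExtendedFromT (J : Ideal (MvPolynomial (MVar v n) K)) : Prop :=
  ∃ A : Set (Fin v → ℕ),
    J = Ideal.span ((fun a => monomial (Tmono v n a) (1 : K)) '' A)

/-- A Cartwright-Sturmfels* ideal: a `ℤ^v`-graded ideal with the same `ℤ^v`-graded Hilbert
series as some ideal extended from `T`. -/
def IsCSstar (J : Ideal (MvPolynomial (MVar v n) K)) : Prop :=
  IsMultigraded J ∧ ∃ C : Ideal (MvPolynomial (MVar v n) K), ExtendedFromT C ∧ sameHS J C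

/-- A monomial ideal. -/
def IsMonomialIdeal (I : Ideal (MvPolynomial (MVar v n) K)) : Prop :=
  ∃ A : Set (MVar v n →₀ ℕ), I = Ideal.span ((fun s => monomial s (1 : K)) '' A)

/-- A squarefree monomial ideal. -/
def IsSqfreeMonomialIdeal (I : Ideal (MvPolynomial (MVar v n) K)) : Prop :=
  ∃ A : Set (MVar v n →₀ ℕ), (∀ s ∈ A, ∀ x, s x ≤ 1) ∧
    I = Ideal.span ((fun s => monomial s (1 : K)) '' A)

/-- `J` is the Alexander dual of the squarefree monomial ideal `I`: `J` is generated by the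
products `∏_{x ∈ P} x` as `P` ranges over the minimal primes of `I`. -/
def IsAlexanderDual (I J : Ideal (MvPolynomial (MVar v n) K)) : Prop :=
  J = Ideal.span {m | ∃ F : Finset (MVar v n),
    Ideal.span ((fun x => (X x : MvPolynomial (MVar v n) K)) '' ↑F) ∈ I.minimalPrimes ∧
    m = ∏ x ∈ F, X x}

/-- The sequence `x_{i j} - λ_{i j} x_{i 1}`, `1 ≤ i ≤ v`, `2 ≤ j ≤ n_i`, as a list. -/
def LamList (lam : MVar v n → K) : List (MvPolynomial (MVar v n) K) :=
  (List.finRange v).flatMap fun i =>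
    ((List.finRange (n i + 1)).drop 1).map fun j =>
      X (⟨i, j⟩ : MVar v n) - C (lam ⟨i, j⟩) * X (⟨i, 0⟩ : MVar v n)

/-- A property of the scalars `λ = (λ_{i j})` holds for general `λ ∈ K^N` if there is a
nonzero polynomial `h` in the `λ_{i j}` such that the property holds whenever `h(λ) ≠ 0`. -/
def GenericallyLam {v : ℕ} {n : Fin v → ℕ} (K : Type) [Field K]
    (P : (MVar v n → K) → Prop) : Prop :=
  ∃ h : MvPolynomial (MVar v n) K, h ≠ 0 ∧
    ∀ lam : MVar v n → K, eval lam h ≠ 0 → P lam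

variable {K : Type} [Field K] {v : ℕ} {n : Fin v → ℕ}

/-- A graded free resolution of an ideal `I` of a polynomial ring graded by an additive
monoid `M` via a weight function `w` on the variables:
`⋯ → F_2 → F_1 → F_0 → I → 0`, where `F_p` is the free module with (finite) basis `ι p`,
the basis element `i : ι p` having degree `deg p i ∈ M`, all maps are graded of degree `0`,
and the complex is exact. -/
structure GradedFreeResolution (σ : Type) (K : Type) [Field K] (M : Type) [AddCommMonoid M]
    (w : σ → M) (I : Ideal (MvPolynomial σ K)) where
  ι : ℕ → Type
  finite : ∀ p, Finite (ι p)
  deg : ∀ p, ι p → M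
  aug : (ι 0 →₀ MvPolynomial σ K) →ₗ[MvPolynomial σ K] MvPolynomial σ K
  d : ∀ p, (ι (p + 1) →₀ MvPolynomial σ K) →ₗ[MvPolynomial σ K] (ι p →₀ MvPolynomial σ K)
  aug_graded : ∀ i : ι 0, (aug (Finsupp.single i 1)).IsWeightedHomogeneous w (deg 0 i)
  d_graded : ∀ (p : ℕ) (i : ι (p + 1)) (j : ι p),
    (d p (Finsupp.single i 1)) j = 0 ∨
      ∃ b, ((d p (Finsupp.single i 1)) j).IsWeightedHomogeneous w b ∧
        b + deg p j = deg (p + 1) i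
  range_aug : LinearMap.range aug = (I : Submodule (MvPolynomial σ K) (MvPolynomial σ K))
  exact_zero : LinearMap.ker aug = LinearMap.range (d 0)
  exact : ∀ p, LinearMap.ker (d p) = LinearMap.range (d (p + 1))

/-- A graded free resolution is minimal if all entries of the matrices of the differentials
between free modules lie in the irrelevant maximal ideal, i.e. have zero constant term. -/
def GradedFreeResolution.Minimal {σ M : Type} [AddCommMonoid M] {w : σ → M}
    {I : Ideal (MvPolynomial σ K)} (F : GradedFreeResolution σ K M w I) : Prop :=
  ∀ (p : ℕ) (i : F.ι (p + 1)) (j : F.ι p),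
    MvPolynomial.constantCoeff ((F.d p (Finsupp.single i 1)) j) = 0

/-- The graded Betti number `β_{p,a}` read off from a (minimal) graded free resolution:
the number of basis elements of `F_p` of degree `a`. -/
def GradedFreeResolution.betti {σ M : Type} [AddCommMonoid M] {w : σ → M}
    {I : Ideal (MvPolynomial σ K)} (F : GradedFreeResolution σ K M w I) (p : ℕ) (a : M) :
    ℕ :=
  Nat.card {i : F.ι p // F.deg p i = a}

/-- The set of `t × t` minors of the matrix `A`. -/
def minorsSet {R : Type} [CommRing R] (t : ℕ) {m N : ℕ} (A : Matrix (Fin m) (Fin N) R) :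
    Set R :=
  {d | ∃ (r : Fin t → Fin m) (c : Fin t → Fin N),
    Function.Injective r ∧ Function.Injective c ∧ d = (A.submatrix r c).det}

/-- `I_t(A)`, the ideal generated by the `t × t` minors of `A`. -/
def minorsIdeal {R : Type} [CommRing R] (t : ℕ) {m N : ℕ}
    (A : Matrix (Fin m) (Fin N) R) : Ideal R :=
  Ideal.span (minorsSet t A)

/-- `A` is column-graded: `N ≤ v` and each entry of the `j`-th column is either `0` or
multihomogeneous of degree `e_j ∈ ℤ^v`. -/
def ColumnGraded {m N : ℕ} (A : Matrix (Fin m) (Fin N) (MvPolynomial (MVar v n) K)) :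
    Prop :=
  ∃ h : N ≤ v, ∀ i j, A i j = 0 ∨
    (A i j).IsWeightedHomogeneous (wt v n) (Pi.single (Fin.castLE h j) 1)

/-- `A` is row-graded: `m ≤ v` and each entry of the `i`-th row is either `0` or
multihomogeneous of degree `e_i ∈ ℤ^v`. -/
def RowGraded {m N : ℕ} (A : Matrix (Fin m) (Fin N) (MvPolynomial (MVar v n) K)) : Prop :=
  ∃ h : m ≤ v, ∀ i j, A i j = 0 ∨
    (A i j).IsWeightedHomogeneous (wt v n) (Pi.single (Fin.castLE h i) 1)

/-- The exponent of the polarization of the monomial `x_{1 1}^{a 1} ⋯ x_{v 1}^{a v}` of `T`: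
the squarefree monomial `∏_i x_{i 1} x_{i 2} ⋯ x_{i (a i)}`. -/
def polExp (v : ℕ) (n : Fin v → ℕ) (a : Fin v → ℕ) : MVar v n →₀ ℕ :=
  ∑ i : Fin v, ∑ j ∈ Finset.univ.filter (fun j : Fin (n i + 1) => (j : ℕ) < a i),
    Finsupp.single (⟨i, j⟩ : MVar v n) 1

/-- `P = pol(C)`, the polarization of an ideal `C` extended from `T`
(the exponents of the generators of `C` must fit inside `S`). -/
def IsPolarizationOfT (C P : Ideal (MvPolynomial (MVar v n) K)) : Prop :=
  ∃ A : Set (Fin v → ℕ), (∀ a ∈ A, ∀ i, a i ≤ n i + 1) ∧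
    C = Ideal.span ((fun a => monomial (Tmono v n a) (1 : K)) '' A) ∧
    P = Ideal.span ((fun a => monomial (polExp v n a) (1 : K)) '' A)

/-- `ψ` is an identification of the quotient of `S` by the `ℤ^v`-graded ideal `Q` with a
standard `ℤ^v`-graded polynomial ring, compatible with the gradings. -/
def IsGradedStructureIso {n₂ : Fin v → ℕ} (Q : Ideal (MvPolynomial (MVar v n) K))
    (ψ : (MvPolynomial (MVar v n) K ⧸ Q) ≃ₐ[K] MvPolynomial (MVar v n₂) K) : Prop :=
  ∀ (f : MvPolynomial (MVar v n) K) (a : Fin v → ℕ),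
    f.IsWeightedHomogeneous (wt v n) a →
      (ψ (Ideal.Quotient.mk Q f)).IsWeightedHomogeneous (wt v n₂) a

end CSPaper

open CSPaper

namespace CSPaper

open scoped Classical in
/-- The number of elements of `U` in each row. -/
def rowCount (v : ℕ) (n : Fin v → ℕ) (U : Finset (MVar v n)) : Fin v → ℕ :=
  fun i => (U.filter fun x => x.1 = i).card

section MonomialIdeals

variable {K : Type} [Field K] {v : ℕ} {n : Fin v → ℕ}

/-- `I` is the monomial ideal whose monomials are those with exponents in `M`. -/
def HasExponents (I : Ideal (MvPolynomial (MVar v n) K)) (M : Set (MVar v n →₀ ℕ)) : Prop :=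
  ∀ f, f ∈ I ↔ ∀ m ∈ f.support, m ∈ M

lemma hasExponents_span (A : Set (MVar v n →₀ ℕ)) :
    HasExponents (Ideal.span ((fun s => monomial s (1 : K)) '' A)) {m | ∃ s ∈ A, s ≤ m} :=
  fun _ => mem_ideal_span_monomial_image

lemma HasExponents.congr {I J : Ideal (MvPolynomial (MVar v n) K)} {M : Set (MVar v n →₀ ℕ)}
    (hI : HasExponents I M) (hJ : HasExponents J M) : I = J := by
  ext f
  rw [hI, hJ]

lemma HasExponents.monomial_mem {I : Ideal (MvPolynomial (MVar v n) K)}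
    {M : Set (MVar v n →₀ ℕ)} (hI : HasExponents I M) (m : MVar v n →₀ ℕ) :
    monomial m (1 : K) ∈ I ↔ m ∈ M := by
  classical
  rw [hI, support_monomial]
  simp

lemma HasExponents.isMultigraded {I : Ideal (MvPolynomial (MVar v n) K)}
    {M : Set (MVar v n →₀ ℕ)} (hI : HasExponents I M) : IsMultigraded I := by
  classical
  intro f hf a
  rw [hI] at hf ⊢
  intro m hm
  rw [support_weightedHomogeneousComponent] at hm
  exact hf m (Finset.mem_filter.1 hm).1

/-- Exponents of multidegree `a`. -/
def degreeSet (v : ℕ) (n : Fin v → ℕ) (a : Fin v → ℕ) : Set (MVar v n →₀ ℕ) :=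
  {m | Finsupp.weight (wt v n) m = a}

lemma weight_wt_apply (m : MVar v n →₀ ℕ) (i : Fin v) :
    Finsupp.weight (wt v n) m i = ∑ j, m ⟨i, j⟩ := by
  classical
  rw [Finsupp.weight_apply, Finsupp.sum_fintype _ _ (by simp), Finset.sum_apply,
    Fintype.sum_sigma, Finset.sum_eq_single i]
  · simp [wt]
  · intro b _ hb
    simp [wt, hb]
  · simp

lemma degreeSet_finite (a : Fin v → ℕ) : (degreeSet v n a).Finite := by
  refine ((Set.finite_Iic (Finsupp.equivFunOnFinite.symm
    fun x : MVar v n => a x.1))).subset fun m hm => ?_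
  intro x
  have h := congrFun (show Finsupp.weight (wt v n) m = a from hm) x.1
  rw [weight_wt_apply] at h
  simp only [Finsupp.equivFunOnFinite_symm_apply_apply, ← h]
  exact Finset.single_le_sum (f := fun j => m ⟨x.1, j⟩) (fun _ _ => Nat.zero_le _)
    (Finset.mem_univ x.2)

lemma HasExponents.hilb_eq {I : Ideal (MvPolynomial (MVar v n) K)}
    {M : Set (MVar v n →₀ ℕ)} (hI : HasExponents I M) (a : Fin v → ℕ) :
    hilb I a = (M ∩ degreeSet v n a).ncard := by
  have : (Submodule.restrictScalars K I ⊓ weightedHomogeneousSubmodule K (wt v n) a :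
      Submodule K (MvPolynomial (MVar v n) K)) = restrictSupport K (M ∩ degreeSet v n a) := by
    ext f
    rw [mem_restrictSupport_iff, Set.subset_inter_iff, Submodule.mem_inf,
      Submodule.restrictScalars_mem, hI, mem_weightedHomogeneousSubmodule]
    refine and_congr (by rfl) ?_
    simp only [IsWeightedHomogeneous, Set.subset_def, degreeSet, Finset.mem_coe, mem_support_iff,
      Set.mem_ofPred_eq]
  rw [hilb, this, Module.finrank_eq_nat_card_basis (basisRestrictSupport K _),
    Nat.card_coe_set_eq]

/-- `I` is the squarefree monomial ideal generated by the squarefree monomials with supports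
in the upper set `U`. -/
def HasSupports (I : Ideal (MvPolynomial (MVar v n) K)) (U : Set (Finset (MVar v n))) : Prop :=
  IsUpperSet U ∧ HasExponents I {m | m.support ∈ U}

lemma HasSupports.congr {I J : Ideal (MvPolynomial (MVar v n) K)} {U : Set (Finset (MVar v n))}
    (hI : HasSupports I U) (hJ : HasSupports J U) : I = J :=
  hI.2.congr hJ.2

/-- The characteristic exponent of a finite set of variables. -/
def indExp (U : Finset (MVar v n)) : MVar v n →₀ ℕ := ∑ x ∈ U, Finsupp.single x 1

lemma indExp_apply (U : Finset (MVar v n)) (x : MVar v n) [Decidable (x ∈ U)] :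
    indExp U x = if x ∈ U then 1 else 0 := by
  classical
  simp [indExp, Finsupp.finsetSum_apply, Finsupp.single_apply]

lemma support_indExp (U : Finset (MVar v n)) : (indExp U).support = U := by
  classical
  ext x
  simp [indExp_apply]

lemma prod_X_eq (U : Finset (MVar v n)) :
    ∏ x ∈ U, (X x : MvPolynomial (MVar v n) K) = monomial (indExp U) 1 := by
  rw [indExp, monomial_sum_one]
  rfl

lemma HasSupports.prod_mem {I : Ideal (MvPolynomial (MVar v n) K)}
    {U : Set (Finset (MVar v n))} (hI : HasSupports I U) (F : Finset (MVar v n)) :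
    ∏ x ∈ F, (X x : MvPolynomial (MVar v n) K) ∈ I ↔ F ∈ U := by
  rw [prod_X_eq, hI.2.monomial_mem, Set.mem_ofPred_eq, support_indExp]

lemma le_iff_support_subset {s m : MVar v n →₀ ℕ} (hs : ∀ x, s x ≤ 1) :
    s ≤ m ↔ s.support ⊆ m.support := by
  constructor
  · exact fun h => Finsupp.support_mono h
  · intro h x
    by_cases hx : s x = 0
    · omega
    · have := h (Finsupp.mem_support_iff.2 hx)
      rw [Finsupp.mem_support_iff] at this
      have := hs x
      omega

lemma hasSupports_span (A : Set (MVar v n →₀ ℕ)) (hA : ∀ s ∈ A, ∀ x, s x ≤ 1) :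
    HasSupports (Ideal.span ((fun s => monomial s (1 : K)) '' A))
      {U | ∃ s ∈ A, s.support ⊆ U} := by
  constructor
  · rintro U V hUV ⟨s, hs, h⟩
    exact ⟨s, hs, h.trans hUV⟩
  · have := hasExponents_span (K := K) A
    convert this using 1
    ext m
    simp only [Set.mem_ofPred_eq]
    exact exists_congr fun s => and_congr_right fun hs => (le_iff_support_subset (hA s hs)).symm

lemma IsSqfreeMonomialIdeal.hasSupports {I : Ideal (MvPolynomial (MVar v n) K)}
    (hI : IsSqfreeMonomialIdeal I) : ∃ U, HasSupports I U := by
  obtain ⟨A, hA, rfl⟩ := hI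
  exact ⟨_, hasSupports_span A hA⟩

lemma hasSupports_span_prod {U : Set (Finset (MVar v n))} (hU : IsUpperSet U) :
    HasSupports (Ideal.span ((fun F => ∏ x ∈ F, (X x : MvPolynomial (MVar v n) K)) '' U)) U := by
  have := hasSupports_span (K := K) (indExp '' U) (by
    classical
    rintro _ ⟨F, -, rfl⟩ x
    rw [indExp_apply]
    split_ifs <;> simp)
  convert this using 1
  · rw [Set.image_image]
    simp_rw [prod_X_eq]
  · ext F
    simp only [Set.mem_image, exists_exists_and_eq_and, support_indExp, Set.mem_ofPred_eq]
    exact ⟨fun h => ⟨F, h, subset_rfl⟩, fun ⟨G, hG, h⟩ => hU h hG⟩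

end MonomialIdeals

section Hilbert

variable {K : Type} [Field K] {v : ℕ} {n : Fin v → ℕ}

/-- The number of exponents of multidegree `a` with support `U`. -/
def suppCount (U : Finset (MVar v n)) (a : Fin v → ℕ) : ℕ :=
  ({m | m.support = U} ∩ degreeSet v n a).ncard

open scoped Classical in
lemma HasSupports.hilb_eq {I : Ideal (MvPolynomial (MVar v n) K)}
    {U : Set (Finset (MVar v n))} (hI : HasSupports I U) (a : Fin v → ℕ) :
    hilb I a = ∑ F with F ∈ U, suppCount F a := by
  have key : ∀ s : Finset (Finset (MVar v n)),
      ({m | m.support ∈ s} ∩ degreeSet v n a).ncard = ∑ F ∈ s, suppCount F a := by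
    intro s
    induction s using Finset.induction_on with
    | empty => simp
    | insert F s hF ih =>
      rw [Finset.sum_insert hF, ← ih, suppCount, ← Set.ncard_union_eq
        _ ((degreeSet_finite a).subset Set.inter_subset_right)
        ((degreeSet_finite a).subset Set.inter_subset_right)]
      · congr 1
        ext m
        simp only [Finset.mem_insert, Set.mem_inter_iff, Set.mem_ofPred_eq, Set.mem_union]
        tauto
      · rw [Set.disjoint_left]
        rintro m ⟨rfl, -⟩ ⟨h, -⟩
        exact hF h
  rw [hI.2.hilb_eq, ← key]
  simp

lemma rowCount_eq_sum (U : Finset (MVar v n)) (i : Fin v) :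
    rowCount v n U i = ∑ j, if (⟨i, j⟩ : MVar v n) ∈ U then 1 else 0 := by
  classical
  rw [← Finset.card_filter, rowCount]
  symm
  refine Finset.card_bij (fun j _ => ⟨i, j⟩) ?_ ?_ ?_
  · intro j hj
    simpa using hj
  · intro j _ k _ h
    simpa using h
  · rintro ⟨i', j⟩ h
    obtain ⟨h, rfl⟩ := Finset.mem_filter.1 h
    exact ⟨j, by simpa using h, rfl⟩

lemma weight_indExp (U : Finset (MVar v n)) :
    Finsupp.weight (wt v n) (indExp U) = rowCount v n U := by
  classical
  ext i
  rw [weight_wt_apply, rowCount_eq_sum]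
  simp_rw [indExp_apply]

lemma rowCount_le (U : Finset (MVar v n)) (i : Fin v) : rowCount v n U i ≤ n i + 1 := by
  classical
  rw [rowCount_eq_sum, ← Finset.card_filter]
  exact (Finset.card_le_univ _).trans (by simp)

lemma rowCount_compl (U : Finset (MVar v n)) (i : Fin v) :
    rowCount v n U i + rowCount v n Uᶜ i = n i + 1 := by
  classical
  rw [rowCount_eq_sum, rowCount_eq_sum, ← Finset.sum_add_distrib]
  rw [Finset.sum_congr rfl (g := fun _ => 1)]
  · simp
  · intro j _
    by_cases h : (⟨i, j⟩ : MVar v n) ∈ U <;> simp [h]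

lemma rowCount_compl_eq_iff (U V : Finset (MVar v n)) :
    rowCount v n Uᶜ = rowCount v n V ↔ rowCount v n U = rowCount v n Vᶜ := by
  simp only [funext_iff]
  refine forall_congr' fun i => ?_
  have := rowCount_compl U i
  have := rowCount_compl V i
  omega

lemma exists_perm_of_card_eq {α : Type*} [Fintype α] [DecidableEq α] {s t : Finset α}
    (h : s.card = t.card) : ∃ π : Equiv.Perm α, ∀ x, x ∈ s ↔ π x ∈ t := by
  refine ⟨(Finset.equivOfCardEq h).extendSubtype, fun x => ⟨fun hx => ?_, fun hx => ?_⟩⟩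
  · exact (Finset.equivOfCardEq h).extendSubtype_mem x hx
  · by_contra hx'
    exact (Finset.equivOfCardEq h).extendSubtype_not_mem x hx' hx

lemma exists_rowPerm {U V : Finset (MVar v n)} (h : rowCount v n U = rowCount v n V) :
    ∃ π : ∀ i, Equiv.Perm (Fin (n i + 1)), ∀ i j,
      (⟨i, j⟩ : MVar v n) ∈ U ↔ (⟨i, π i j⟩ : MVar v n) ∈ V := by
  classical
  have : ∀ i, ∃ π : Equiv.Perm (Fin (n i + 1)), ∀ j,
      (⟨i, j⟩ : MVar v n) ∈ U ↔ (⟨i, π j⟩ : MVar v n) ∈ V := by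
    intro i
    have h := congrFun h i
    simp only [rowCount_eq_sum, ← Finset.card_filter] at h
    obtain ⟨π, hπ⟩ := exists_perm_of_card_eq h
    exact ⟨π, by simpa using hπ⟩
  choose π hπ using this
  exact ⟨π, hπ⟩

lemma suppCount_congr {U V : Finset (MVar v n)} (h : rowCount v n U = rowCount v n V)
    (a : Fin v → ℕ) : suppCount U a = suppCount V a := by
  obtain ⟨π, hπ⟩ := exists_rowPerm h
  let e : Equiv.Perm (MVar v n) := Equiv.sigmaCongrRight π
  have he : ∀ x, x ∈ U ↔ e x ∈ V := fun ⟨i, j⟩ => hπ i j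
  refine Set.ncard_congr' ((Finsupp.domCongr (M := ℕ) e).toEquiv.subtypeEquiv fun m => ?_)
  have h1 : ∀ x, (Finsupp.domCongr e m) x = m (e.symm x) := fun x => rfl
  change _ ↔ Finsupp.domCongr e m ∈ _
  refine and_congr ?_ ?_
  · simp only [Set.mem_ofPred_eq, Finset.ext_iff, Finsupp.mem_support_iff, h1, he]
    constructor
    · intro H x
      simpa using H (e.symm x)
    · intro H x
      simpa using H (e x)
  · simp only [degreeSet, Set.mem_ofPred_eq, funext_iff, weight_wt_apply, h1]
    refine forall_congr' fun i => ?_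
    rw [← Equiv.sum_comp (π i) fun j => m (e.symm ⟨i, j⟩)]
    have : ∀ j, e.symm ⟨i, π i j⟩ = ⟨i, j⟩ := fun j => by
      rw [Equiv.symm_apply_eq]
      rfl
    simp [this]

lemma support_subset_weight (m : MVar v n →₀ ℕ) :
    rowCount v n m.support ≤ Finsupp.weight (wt v n) m := by
  classical
  intro i
  rw [weight_wt_apply, rowCount_eq_sum]
  refine Finset.sum_le_sum fun j _ => ?_
  split_ifs with h
  · exact Nat.one_le_iff_ne_zero.2 (Finsupp.mem_support_iff.1 h)
  · exact Nat.zero_le _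

lemma suppCount_eq_zero {U : Finset (MVar v n)} {a : Fin v → ℕ} (h : ¬ rowCount v n U ≤ a) :
    suppCount U a = 0 := by
  rw [suppCount, Set.ncard_eq_zero ((degreeSet_finite a).subset Set.inter_subset_right),
    Set.eq_empty_iff_forall_notMem]
  rintro m ⟨rfl, rfl⟩
  exact h (support_subset_weight m)

lemma suppCount_self (U : Finset (MVar v n)) : suppCount U (rowCount v n U) = 1 := by
  classical
  rw [suppCount, Set.ncard_eq_one]
  refine ⟨indExp U, Set.eq_singleton_iff_unique_mem.2
    ⟨⟨support_indExp U, weight_indExp U⟩, ?_⟩⟩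
  rintro m ⟨rfl, hm⟩
  have hm : Finsupp.weight (wt v n) m = _ := hm
  symm
  have hle : ∀ x, indExp m.support x ≤ m x := by
    intro x
    rw [indExp_apply]
    split_ifs with h
    · rw [Finsupp.mem_support_iff] at h
      omega
    · exact Nat.zero_le _
  ext ⟨i, j⟩
  have h1 := congrFun hm i
  rw [← weight_indExp, weight_wt_apply, weight_wt_apply, eq_comm,
    Finset.sum_eq_sum_iff_of_le fun j _ => hle _] at h1
  exact h1 j (Finset.mem_univ _)

open scoped Classical in
/-- The number of members of `U` with row counts `b`. -/
def faceCount (U : Set (Finset (MVar v n))) (b : Fin v → ℕ) : ℕ :=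
  (Finset.univ.filter fun F => F ∈ U ∧ rowCount v n F = b).card

open scoped Classical in
lemma HasSupports.hilb_eq_sum_faceCount {I : Ideal (MvPolynomial (MVar v n) K)}
    {U : Set (Finset (MVar v n))} (hI : HasSupports I U) (r : (Fin v → ℕ) → Finset (MVar v n))
    (hr : ∀ F, rowCount v n (r (rowCount v n F)) = rowCount v n F) (a : Fin v → ℕ) :
    hilb I a = ∑ b ∈ Finset.univ.image (rowCount v n), faceCount U b * suppCount (r b) a := by
  rw [hI.hilb_eq, ← Finset.sum_fiberwise_of_maps_to (t := Finset.univ.image (rowCount v n))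
    (g := rowCount v n) fun F _ => Finset.mem_image_of_mem _ (Finset.mem_univ F)]
  refine Finset.sum_congr rfl fun b hb => ?_
  rw [Finset.sum_congr rfl (g := fun _ => suppCount (r b) a), Finset.sum_const, smul_eq_mul,
    Finset.filter_filter, faceCount]
  intro F hF
  obtain rfl := (Finset.mem_filter.1 hF).2
  exact suppCount_congr (hr F).symm a

lemma HasSupports.sameHS_iff {I J : Ideal (MvPolynomial (MVar v n) K)}
    {U V : Set (Finset (MVar v n))} (hI : HasSupports I U) (hJ : HasSupports J V) :
    sameHS I J ↔ ∀ F, faceCount U (rowCount v n F) = faceCount V (rowCount v n F) := by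
  classical
  let r := Function.invFun (rowCount v n)
  have hr : ∀ F, rowCount v n (r (rowCount v n F)) = rowCount v n F :=
    fun F => Function.invFun_eq ⟨F, rfl⟩
  constructor
  · intro h F
    induction hb : rowCount v n F using WellFoundedLT.induction generalizing F with
    | ind b ih =>
      subst hb
      have h1 := h (rowCount v n F)
      have hF : rowCount v n F ∈ Finset.univ.image (rowCount v n) :=
        Finset.mem_image_of_mem _ (Finset.mem_univ F)
      rw [hI.hilb_eq_sum_faceCount r hr, hJ.hilb_eq_sum_faceCount r hr,
        ← Finset.add_sum_erase _ _ hF, ← Finset.add_sum_erase _ _ hF,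
        suppCount_congr (hr F), suppCount_self, mul_one, mul_one] at h1
      rw [Finset.sum_congr rfl
        (g := fun b => faceCount V b * suppCount (r b) (rowCount v n F))] at h1
      · exact Nat.add_right_cancel h1
      · intro b hb
        obtain ⟨hne, hb⟩ := Finset.mem_erase.1 hb
        obtain ⟨G, -, rfl⟩ := Finset.mem_image.1 hb
        by_cases hle : rowCount v n G ≤ rowCount v n F
        · rw [ih _ (lt_of_le_of_ne hle hne) G rfl]
        · rw [suppCount_eq_zero (by rwa [hr]), mul_zero, mul_zero]
  · intro h a
    rw [hI.hilb_eq_sum_faceCount r hr, hJ.hilb_eq_sum_faceCount r hr]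
    refine Finset.sum_congr rfl fun b hb => ?_
    obtain ⟨G, -, rfl⟩ := Finset.mem_image.1 hb
    rw [h]

/-- The supports of the Alexander dual. -/
def dualSupports (U : Set (Finset (MVar v n))) : Set (Finset (MVar v n)) :=
  {F | Fᶜ ∉ U}

lemma isUpperSet_dualSupports {U : Set (Finset (MVar v n))} (hU : IsUpperSet U) :
    IsUpperSet (dualSupports U) := by
  classical
  intro F G h hF hG
  exact hF (hU (Finset.compl_subset_compl.2 h) hG)

lemma dualSupports_dualSupports (U : Set (Finset (MVar v n))) :
    dualSupports (dualSupports U) = U := by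
  ext F
  simp [dualSupports]

lemma faceCount_dualSupports (U : Set (Finset (MVar v n)))
    (F : Finset (MVar v n)) :
    faceCount (dualSupports U) (rowCount v n F) + faceCount U (rowCount v n Fᶜ) =
      faceCount (n := n) Set.univ (rowCount v n F) := by
  classical
  have h : faceCount U (rowCount v n Fᶜ) =
      (Finset.univ.filter fun G => Gᶜ ∈ U ∧ rowCount v n G = rowCount v n F).card := by
    refine Finset.card_bij (fun G _ => Gᶜ) ?_ ?_ ?_
    · intro G hG
      simpa [rowCount_compl_eq_iff] using hG
    · intro G _ H _ h
      exact compl_injective h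
    · intro G hG
      refine ⟨Gᶜ, ?_, compl_compl G⟩
      simpa [rowCount_compl_eq_iff] using hG
  have h' : faceCount (dualSupports U) (rowCount v n F) =
      (Finset.univ.filter fun G => ¬ Gᶜ ∈ U ∧ rowCount v n G = rowCount v n F).card := by
    unfold faceCount dualSupports
    congr! 3
  rw [h, h', faceCount, ← Finset.card_union_of_disjoint]
  · congr 1
    ext G
    simp only [Finset.mem_union, Finset.mem_filter, Finset.mem_univ, true_and, Set.mem_univ]
    tauto
  · rw [Finset.disjoint_left]
    intro G hG hG'
    simp only [Finset.mem_filter] at hG hG'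
    tauto

lemma HasSupports.sameHS_dual {I J I' J' : Ideal (MvPolynomial (MVar v n) K)}
    {U V : Set (Finset (MVar v n))} (hI : HasSupports I U) (hJ : HasSupports J V)
    (hI' : HasSupports I' (dualSupports U)) (hJ' : HasSupports J' (dualSupports V))
    (h : sameHS I J) : sameHS I' J' := by
  classical
  rw [hI.sameHS_iff hJ] at h
  rw [hI'.sameHS_iff hJ']
  intro F
  have h1 := faceCount_dualSupports U F
  have h2 := faceCount_dualSupports V F
  have := h Fᶜ
  omega

end Hilbert

section VariableIdeals

variable {K : Type} [Field K] {v : ℕ} {n : Fin v → ℕ}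

variable (K) in
/-- The prime ideal generated by the variables in `F`. -/
def varIdeal (F : Finset (MVar v n)) : Ideal (MvPolynomial (MVar v n) K) :=
  Ideal.span ((fun x => (X x : MvPolynomial (MVar v n) K)) '' ↑F)

lemma mem_varIdeal {F : Finset (MVar v n)} {f : MvPolynomial (MVar v n) K} :
    f ∈ varIdeal K F ↔ ∀ m ∈ f.support, ∃ x ∈ F, m x ≠ 0 :=
  mem_ideal_span_X_image

lemma X_mem_varIdeal {F : Finset (MVar v n)} {x : MVar v n} :
    (X x : MvPolynomial (MVar v n) K) ∈ varIdeal K F ↔ x ∈ F := by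
  classical
  rw [mem_varIdeal, support_X]
  simp only [Finset.mem_singleton, forall_eq, Finsupp.single_apply]
  exact ⟨fun ⟨y, hy, h⟩ => by
    obtain rfl : x = y := by
      by_contra hne
      exact h (if_neg hne)
    exact hy, fun h => ⟨x, h, by simp⟩⟩

lemma varIdeal_isPrime (F : Finset (MVar v n)) : (varIdeal K F).IsPrime := by
  classical
  let φ : MvPolynomial (MVar v n) K →ₐ[K] MvPolynomial (MVar v n) K :=
    aeval fun x => if x ∈ F then 0 else X x
  have h1 : varIdeal K F ≤ RingHom.ker φ := by
    rw [varIdeal, Ideal.span_le]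
    rintro _ ⟨x, hx, rfl⟩
    have hx : x ∈ F := hx
    simp [φ, hx]
  have h2 : (Ideal.Quotient.mkₐ K (varIdeal K F)).comp φ = Ideal.Quotient.mkₐ K (varIdeal K F) := by
    ext x
    by_cases hx : x ∈ F
    · simpa [φ, hx] using (Ideal.Quotient.eq_zero_iff_mem.2 (X_mem_varIdeal.2 hx)).symm
    · simp [φ, hx]
  have h3 : varIdeal K F = RingHom.ker φ := by
    refine le_antisymm h1 fun f hf => ?_
    have := DFunLike.congr_fun h2 f
    rw [AlgHom.comp_apply, show φ f = 0 from hf, map_zero] at this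
    exact Ideal.Quotient.eq_zero_iff_mem.1 this.symm
  rw [h3]
  exact RingHom.ker_isPrime φ

lemma HasSupports.le_varIdeal_iff {I : Ideal (MvPolynomial (MVar v n) K)}
    {U : Set (Finset (MVar v n))} (hI : HasSupports I U) (F : Finset (MVar v n)) :
    I ≤ varIdeal K F ↔ F ∈ dualSupports U := by
  classical
  constructor
  · intro h hF
    have := h ((hI.prod_mem _).2 hF)
    rw [(varIdeal_isPrime F).prod_mem_iff] at this
    obtain ⟨x, hx, hx'⟩ := this
    exact Finset.mem_compl.1 hx (X_mem_varIdeal.1 hx')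
  · intro h f hf
    rw [hI.2] at hf
    rw [mem_varIdeal]
    intro m hm
    by_contra! hx
    refine h (hI.1 (fun x hxm => Finset.mem_compl.2 fun hxF => ?_) (hf m hm))
    exact Finsupp.mem_support_iff.1 hxm (hx x hxF)

lemma HasSupports.exists_eq_varIdeal {I Q : Ideal (MvPolynomial (MVar v n) K)}
    {U : Set (Finset (MVar v n))} (hI : HasSupports I U) (hQ : Q ∈ I.minimalPrimes) :
    ∃ F, Q = varIdeal K F := by
  classical
  have hQp : Q.IsPrime := hQ.1.1
  let F : Finset (MVar v n) := Finset.univ.filter fun x => X x ∈ Q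
  have hF : ∀ x, x ∈ F ↔ (X x : MvPolynomial (MVar v n) K) ∈ Q := fun x => by simp [F]
  have hle : varIdeal K F ≤ Q := by
    rw [varIdeal, Ideal.span_le]
    rintro _ ⟨x, hx, rfl⟩
    exact (hF x).1 hx
  refine ⟨F, le_antisymm (hQ.2 ⟨varIdeal_isPrime F, ?_⟩ hle) hle⟩
  rw [hI.le_varIdeal_iff]
  intro h
  have := hQ.1.2 ((hI.prod_mem _).2 h)
  rw [hQp.prod_mem_iff] at this
  obtain ⟨x, hx, hx'⟩ := this
  exact Finset.mem_compl.1 hx ((hF x).2 hx')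

lemma IsAlexanderDual.hasSupports {I J : Ideal (MvPolynomial (MVar v n) K)}
    {U : Set (Finset (MVar v n))} (hI : HasSupports I U) (hJ : IsAlexanderDual I J) :
    HasSupports J (dualSupports U) := by
  have key : J = Ideal.span
      ((fun F => ∏ x ∈ F, (X x : MvPolynomial (MVar v n) K)) '' dualSupports U) := by
    rw [hJ]
    apply le_antisymm
    · rw [Ideal.span_le]
      rintro _ ⟨F, hF, rfl⟩
      exact Ideal.subset_span ⟨F, (hI.le_varIdeal_iff F).1 hF.1.2, rfl⟩
    · rw [Ideal.span_le]
      rintro _ ⟨F, hF, rfl⟩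
      have hp := varIdeal_isPrime (K := K) F
      obtain ⟨Q, hQ, hQF⟩ := Ideal.exists_minimalPrimes_le ((hI.le_varIdeal_iff F).2 hF)
      obtain ⟨G, rfl⟩ := hI.exists_eq_varIdeal hQ
      have hGF : G ⊆ F := fun x hx => X_mem_varIdeal.1 (hQF (X_mem_varIdeal.2 hx))
      exact Ideal.mem_of_dvd _ (Finset.prod_dvd_prod_of_subset _ _ _ hGF)
        (Ideal.subset_span ⟨G, hQ, rfl⟩)
  rw [key]
  exact hasSupports_span_prod (isUpperSet_dualSupports hI.1)

/-- The first `a i` variables of each row `i`. -/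
def initSeg (v : ℕ) (n : Fin v → ℕ) (a : Fin v → ℕ) : Finset (MVar v n) :=
  Finset.univ.filter fun x => (x.2 : ℕ) < a x.1

lemma mem_initSeg {a : Fin v → ℕ} {x : MVar v n} : x ∈ initSeg v n a ↔ (x.2 : ℕ) < a x.1 := by
  simp [initSeg]

lemma polExp_eq (a : Fin v → ℕ) : polExp v n a = indExp (initSeg v n a) := by
  rw [polExp, indExp, initSeg, Finset.sum_filter, Fintype.sum_sigma]
  simp_rw [Finset.sum_filter]

lemma hasSupports_pol (A : Set (Fin v → ℕ)) :
    HasSupports (Ideal.span ((fun a => monomial (polExp v n a) (1 : K)) '' A))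
      {U | ∃ a ∈ A, initSeg v n a ⊆ U} := by
  have := hasSupports_span (K := K) (polExp v n '' A) (by
    rintro _ ⟨F, -, rfl⟩ x
    rw [polExp_eq, indExp_apply]
    split_ifs <;> simp)
  rw [Set.image_image] at this
  convert this using 1
  ext F
  simp only [Set.mem_image, exists_exists_and_eq_and, polExp_eq, support_indExp,
    Set.mem_ofPred_eq]

variable (K) in
/-- The intersection of the primes generated by initial segments of sizes in `A`. -/
def segIdeal (n : Fin v → ℕ) (A : Set (Fin v → ℕ)) : Ideal (MvPolynomial (MVar v n) K) :=
  ⨅ a ∈ A, varIdeal K (initSeg v n a)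

lemma mem_segIdeal {A : Set (Fin v → ℕ)} {f : MvPolynomial (MVar v n) K} :
    f ∈ segIdeal K n A ↔ ∀ a ∈ A, f ∈ varIdeal K (initSeg v n a) := by
  simp only [segIdeal, Submodule.mem_iInf]

lemma hasSupports_segIdeal (A : Set (Fin v → ℕ)) :
    HasSupports (segIdeal K n A) (dualSupports {U | ∃ a ∈ A, initSeg v n a ⊆ U}) := by
  refine ⟨isUpperSet_dualSupports (hasSupports_pol (K := K) A).1, fun f => ?_⟩
  simp only [mem_segIdeal, mem_varIdeal, dualSupports, Set.mem_ofPred_eq, not_exists, not_and]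
  constructor
  · intro h m hm a ha hsub
    obtain ⟨x, hx, hx'⟩ := h a ha m hm
    exact Finset.mem_compl.1 (hsub hx) (Finsupp.mem_support_iff.2 hx')
  · intro h a ha m hm
    by_contra! hx
    exact h m hm a ha fun x hx1 => by simpa using hx x hx1

lemma segIdeal_isRadical (A : Set (Fin v → ℕ)) : (segIdeal K n A).IsRadical := by
  rintro f ⟨k, hk⟩
  rw [mem_segIdeal] at hk ⊢
  exact fun a ha => (varIdeal_isPrime _).mem_of_pow_mem k (hk a ha)

end VariableIdeals

section Polarization

lemma exists_row_polarization (N : ℕ) : ∃ e : (Fin (N + 1) → ℕ) → Fin (N + 1) → ℕ,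
    e.Injective ∧ (∀ m, ∑ j, e m j = ∑ j, m j) ∧
      ∀ m, ∀ s ≤ N + 1, s ≤ e m 0 ↔ ∀ j : Fin (N + 1), (j : ℕ) < s → m j ≠ 0 := by
  classical
  have hlev : ∀ m : Fin (N + 1) → ℕ, ∃ t ≤ N + 1, (∀ j : Fin (N + 1), (j : ℕ) < t → m j ≠ 0) ∧
      ∀ h : t < N + 1, m ⟨t, h⟩ = 0 := by
    intro m
    let P : ℕ → Prop := fun t => ∀ j : Fin (N + 1), (j : ℕ) < t → m j ≠ 0
    have h0 : P 0 := fun j hj => absurd hj (Nat.not_lt_zero _)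
    have h1 : P (Nat.findGreatest P (N + 1)) := Nat.findGreatest_spec (Nat.zero_le _) h0
    refine ⟨Nat.findGreatest P (N + 1), Nat.findGreatest_le _, h1, fun h => ?_⟩
    by_contra hne
    refine Nat.findGreatest_is_greatest (Nat.lt_succ_self _) (Nat.succ_le_of_lt h)
      (show P _ from fun j hj => ?_)
    rcases Nat.lt_succ_iff_lt_or_eq.1 hj with hj | hj
    · exact h1 j hj
    · have : j = ⟨Nat.findGreatest P (N + 1), h⟩ := Fin.ext hj
      rwa [this]
  choose t ht1 ht2 ht3 using hlev
  let σ : ℕ → Equiv.Perm (Fin (N + 1)) :=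
    fun t => if h : t < N + 1 then Equiv.swap 0 ⟨t, h⟩ else 1
  let d : ℕ → (Fin (N + 1) → ℕ) → Fin (N + 1) → ℕ :=
    fun t m j => m j - if (j : ℕ) < t then 1 else 0
  let e : (Fin (N + 1) → ℕ) → Fin (N + 1) → ℕ :=
    fun m j => d (t m) m (σ (t m) j) + if j = 0 then t m else 0
  have he0 : ∀ m, min (e m 0) (N + 1) = t m := by
    intro m
    by_cases h : t m < N + 1
    · have : e m 0 = t m := by
        simp only [e, σ, d, dif_pos h, Equiv.swap_apply_left, ht3 m h]
        simp
      omega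
    · have : t m ≤ e m 0 := by simp [e]
      have := ht1 m
      omega
  have hd : ∀ m j, d (t m) m j + (if (j : ℕ) < t m then 1 else 0) = m j := by
    intro m j
    simp only [d]
    split_ifs with h
    · have := ht2 m j h
      omega
    · omega
  refine ⟨e, fun m m' h => ?_, fun m => ?_, fun m s hs => ?_⟩
  · have ht : t m = t m' := by rw [← he0 m, ← he0 m', h]
    ext j
    rw [← hd m, ← hd m', ht]
    congr 1
    have := congrFun h ((σ (t m')).symm j)
    simp only [e, ht] at this
    have := Nat.add_right_cancel this
    simpa using this
  · simp only [e]
    rw [Finset.sum_add_distrib, Equiv.sum_comp (σ (t m)) (d (t m) m)]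
    have hc : ∑ j : Fin (N + 1), (if (j : ℕ) < t m then 1 else 0) = t m := by
      rw [← Finset.card_filter, Fin.card_filter_val_lt]
      exact min_eq_right (ht1 m)
    rw [← Finset.sum_congr rfl fun j _ => hd m j, Finset.sum_add_distrib, hc]
    simp
  · have h1 : s ≤ e m 0 ↔ s ≤ t m := by
      rw [← he0 m]
      omega
    rw [h1]
    constructor
    · exact fun h j hj => ht2 m j (hj.trans_le h)
    · intro h
      by_contra! hlt
      exact h ⟨t m, hlt.trans_le hs⟩ hlt (ht3 m _)

variable {K : Type} [Field K] {v : ℕ} {n : Fin v → ℕ}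

lemma Tmono_apply_zero (a : Fin v → ℕ) (i : Fin v) : Tmono v n a ⟨i, 0⟩ = a i := by
  classical
  rw [Tmono, Finsupp.finsetSum_apply, Finset.sum_eq_single i]
  · simp
  · intro j _ hj
    rw [Finsupp.single_apply, if_neg]
    intro h
    exact hj (congrArg Sigma.fst h)
  · simp

lemma Tmono_apply_ne (a : Fin v → ℕ) {x : MVar v n} (hx : x.2 ≠ 0) : Tmono v n a x = 0 := by
  classical
  rw [Tmono, Finsupp.finsetSum_apply]
  refine Finset.sum_eq_zero fun i _ => ?_
  rw [Finsupp.single_apply, if_neg]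
  rintro rfl
  exact hx rfl

lemma Tmono_le_iff {a : Fin v → ℕ} {m : MVar v n →₀ ℕ} :
    Tmono v n a ≤ m ↔ ∀ i, a i ≤ m ⟨i, 0⟩ := by
  constructor
  · intro h i
    rw [← Tmono_apply_zero (n := n) a i]
    exact h _
  · rintro h ⟨i, j⟩
    by_cases hj : j = 0
    · subst hj
      rw [Tmono_apply_zero]
      exact h i
    · rw [Tmono_apply_ne a hj]
      exact Nat.zero_le _

lemma weight_Tmono (a : Fin v → ℕ) : Finsupp.weight (wt v n) (Tmono v n a) = a := by
  ext i
  rw [weight_wt_apply, Finset.sum_eq_single 0, Tmono_apply_zero]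
  · exact fun j _ hj => Tmono_apply_ne a hj
  · simp

lemma hasExponents_Tmono (A : Set (Fin v → ℕ)) :
    HasExponents (Ideal.span ((fun a => monomial (Tmono v n a) (1 : K)) '' A))
      {m | ∃ a ∈ A, ∀ i, a i ≤ m ⟨i, 0⟩} := by
  have := hasExponents_span (K := K) (Tmono v n '' A)
  rw [Set.image_image] at this
  convert this using 1
  ext m
  simp only [Set.mem_image, exists_exists_and_eq_and, Tmono_le_iff, Set.mem_ofPred_eq]

lemma sameHS_polarization {A : Set (Fin v → ℕ)} (hA : ∀ a ∈ A, ∀ i, a i ≤ n i + 1) :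
    sameHS (Ideal.span ((fun a => monomial (polExp v n a) (1 : K)) '' A))
      (Ideal.span ((fun a => monomial (Tmono v n a) (1 : K)) '' A)) := by
  choose e he1 he2 he3 using exists_row_polarization
  let Φ : (MVar v n →₀ ℕ) → (MVar v n →₀ ℕ) := fun m =>
    Finsupp.equivFunOnFinite.symm fun x => e (n x.1) (fun j => m ⟨x.1, j⟩) x.2
  have hΦ : ∀ m i j, Φ m ⟨i, j⟩ = e (n i) (fun j => m ⟨i, j⟩) j := fun m i j => rfl
  have hinj : Φ.Injective := by
    intro m m' h
    ext ⟨i, j⟩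
    refine congrFun (he1 (n i) (a₁ := fun j => m ⟨i, j⟩) (a₂ := fun j => m' ⟨i, j⟩) ?_) j
    funext k
    rw [← hΦ, ← hΦ, h]
  have hdeg : ∀ m, Finsupp.weight (wt v n) (Φ m) = Finsupp.weight (wt v n) m := by
    intro m
    ext i
    rw [weight_wt_apply, weight_wt_apply]
    exact he2 (n i) fun j => m ⟨i, j⟩
  intro a
  have himg : Φ '' degreeSet v n a = degreeSet v n a := by
    refine Set.eq_of_subset_of_ncard_le ?_ ?_ (degreeSet_finite a)
    · rintro _ ⟨m, hm, rfl⟩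
      exact (hdeg m).trans hm
    · rw [Set.ncard_image_of_injective _ hinj]
  rw [(hasSupports_pol A).2.hilb_eq, (hasExponents_Tmono A).hilb_eq,
    ← Set.ncard_image_of_injective _ hinj]
  congr 1
  have hmem : ∀ m : MVar v n →₀ ℕ, (∃ a ∈ A, initSeg v n a ⊆ m.support) ↔
      ∃ a ∈ A, ∀ i, a i ≤ Φ m ⟨i, 0⟩ := by
    intro m
    refine exists_congr fun a => and_congr_right fun ha => ?_
    have : ∀ i, a i ≤ Φ m ⟨i, 0⟩ ↔ ∀ j : Fin (n i + 1), (j : ℕ) < a i → m ⟨i, j⟩ ≠ 0 :=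
      fun i => he3 (n i) _ _ (hA a ha i)
    simp only [this, Finset.subset_iff, mem_initSeg, Finsupp.mem_support_iff]
    exact ⟨fun h i j hj => h hj, fun h x hx => h x.1 x.2 hx⟩
  ext m
  constructor
  · rintro ⟨m, ⟨h1, h2⟩, rfl⟩
    exact ⟨(hmem m).1 h1, (hdeg m).trans h2⟩
  · rintro ⟨h1, h2⟩
    rw [← himg] at h2
    obtain ⟨m, h2, rfl⟩ := h2
    exact ⟨m, ⟨(hmem m).2 h1, h2⟩, rfl⟩

end Polarization

section Action

variable {K : Type} [Field K] {v : ℕ} {n : Fin v → ℕ}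

lemma gAct_X (g : ∀ i : Fin v, Matrix (Fin (n i + 1)) (Fin (n i + 1)) K) (x : MVar v n) :
    gAct g (X x) = ∑ k : Fin (n x.1 + 1), C (g x.1 k x.2) * X ⟨x.1, k⟩ := by
  rw [gAct, aeval_X]

lemma gAct_gAct (g h : ∀ i : Fin v, Matrix (Fin (n i + 1)) (Fin (n i + 1)) K)
    (f : MvPolynomial (MVar v n) K) : gAct g (gAct h f) = gAct (fun i => g i * h i) f := by
  have : (gAct g).comp (gAct h) = gAct fun i => g i * h i := by
    refine MvPolynomial.algHom_ext fun x => ?_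
    rw [AlgHom.comp_apply, gAct_X, gAct_X, map_sum]
    simp_rw [map_mul, ← algebraMap_eq, AlgHom.commutes, gAct_X, Finset.mul_sum, Matrix.mul_apply,
      map_sum, Finset.sum_mul, algebraMap_eq, map_mul]
    rw [Finset.sum_comm]
    refine Finset.sum_congr rfl fun k _ => Finset.sum_congr rfl fun l _ => ?_
    ring
  rw [← this, AlgHom.comp_apply]

lemma gAct_one (f : MvPolynomial (MVar v n) K) : gAct (fun _ => 1) f = f := by
  classical
  have : gAct (fun _ => 1) = AlgHom.id K (MvPolynomial (MVar v n) K) := by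
    refine MvPolynomial.algHom_ext fun x => ?_
    rw [gAct_X, Finset.sum_eq_single x.2]
    · simp
    · intro k _ hk
      simp [Matrix.one_apply_ne hk]
    · simp
  rw [this, AlgHom.id_apply]

lemma gAct_inv_gAct {g : ∀ i : Fin v, Matrix (Fin (n i + 1)) (Fin (n i + 1)) K}
    (hg : ∀ i, IsUnit (g i).det) (f : MvPolynomial (MVar v n) K) :
    gAct (fun i => (g i)⁻¹) (gAct g f) = f := by
  rw [gAct_gAct]
  simp_rw [Matrix.nonsing_inv_mul _ (hg _)]
  exact gAct_one f

lemma gAct_gAct_inv {g : ∀ i : Fin v, Matrix (Fin (n i + 1)) (Fin (n i + 1)) K}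
    (hg : ∀ i, IsUnit (g i).det) (f : MvPolynomial (MVar v n) K) :
    gAct g (gAct (fun i => (g i)⁻¹) f) = f := by
  rw [gAct_gAct]
  simp_rw [Matrix.mul_nonsing_inv _ (hg _)]
  exact gAct_one f

lemma mem_map_gAct {g : ∀ i : Fin v, Matrix (Fin (n i + 1)) (Fin (n i + 1)) K}
    (hg : ∀ i, IsUnit (g i).det) {I : Ideal (MvPolynomial (MVar v n) K)}
    {f : MvPolynomial (MVar v n) K} :
    f ∈ Ideal.map (gAct g) I ↔ gAct (fun i => (g i)⁻¹) f ∈ I := by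
  constructor
  · intro h
    have hle : Ideal.map (gAct g) I ≤ Ideal.comap (gAct fun i => (g i)⁻¹) I := by
      rw [Ideal.map_le_iff_le_comap]
      intro q hq
      rw [Ideal.mem_comap, Ideal.mem_comap, gAct_inv_gAct hg]
      exact hq
    exact hle h
  · intro h
    rw [← gAct_gAct_inv hg f]
    exact Ideal.mem_map_of_mem _ h

lemma gAct_monomial (g : ∀ i : Fin v, Matrix (Fin (n i + 1)) (Fin (n i + 1)) K)
    (m : MVar v n →₀ ℕ) (c : K) :
    gAct g (monomial m c) = C c * ∏ x, gAct g (X x) ^ m x := by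
  rw [monomial_eq, map_mul, ← algebraMap_eq, AlgHom.commutes, Finsupp.prod_fintype _ _ (by simp),
    map_prod]
  simp_rw [map_pow]

lemma gAct_monomial_isWeightedHomogeneous
    (g : ∀ i : Fin v, Matrix (Fin (n i + 1)) (Fin (n i + 1)) K) (m : MVar v n →₀ ℕ) (c : K) :
    IsWeightedHomogeneous (wt v n) (gAct g (monomial m c)) (Finsupp.weight (wt v n) m) := by
  rw [gAct_monomial, Finsupp.weight_apply, Finsupp.sum_fintype _ _ (by simp)]
  refine IsWeightedHomogeneous.C_mul (IsWeightedHomogeneous.prod _ _ _ fun x _ => ?_) c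
  refine IsWeightedHomogeneous.pow ?_ _
  rw [gAct_X]
  exact IsWeightedHomogeneous.sum _ _ _ fun k _ =>
    (isWeightedHomogeneous_X K (wt v n) (⟨x.1, k⟩ : MVar v n)).C_mul _

lemma weightedHomogeneousComponent_gAct
    (g : ∀ i : Fin v, Matrix (Fin (n i + 1)) (Fin (n i + 1)) K) (a : Fin v → ℕ)
    (f : MvPolynomial (MVar v n) K) :
    weightedHomogeneousComponent (wt v n) a (gAct g f) =
      gAct g (weightedHomogeneousComponent (wt v n) a f) := by
  classical
  induction f using MvPolynomial.induction_on' with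
  | add p q hp hq => simp only [map_add, hp, hq]
  | monomial m c =>
    rw [weightedHomogeneousComponent_of_mem ((mem_weightedHomogeneousSubmodule _ _ _ _).2
        (gAct_monomial_isWeightedHomogeneous g m c)),
      weightedHomogeneousComponent_of_mem ((mem_weightedHomogeneousSubmodule _ _ _ _).2
        (isWeightedHomogeneous_monomial _ m c rfl))]
    split_ifs <;> simp

lemma IsMultigraded.map_gAct {g : ∀ i : Fin v, Matrix (Fin (n i + 1)) (Fin (n i + 1)) K}
    (hg : ∀ i, IsUnit (g i).det) {I : Ideal (MvPolynomial (MVar v n) K)}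
    (hI : IsMultigraded I) : IsMultigraded (Ideal.map (gAct g) I) := by
  intro f hf a
  rw [mem_map_gAct hg] at hf ⊢
  rw [← weightedHomogeneousComponent_gAct]
  exact hI _ hf a

lemma hilb_map_gAct {g : ∀ i : Fin v, Matrix (Fin (n i + 1)) (Fin (n i + 1)) K}
    (hg : ∀ i, IsUnit (g i).det) (I : Ideal (MvPolynomial (MVar v n) K)) (a : Fin v → ℕ) :
    hilb (Ideal.map (gAct g) I) a = hilb I a := by
  classical
  let e : MvPolynomial (MVar v n) K ≃ₗ[K] MvPolynomial (MVar v n) K :=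
    LinearEquiv.ofLinearMap (gAct g).toLinearMap (gAct fun i => (g i)⁻¹).toLinearMap
      (LinearMap.ext fun f => gAct_gAct_inv hg f) (LinearMap.ext fun f => gAct_inv_gAct hg f)
  have hhom : ∀ (h : ∀ i : Fin v, Matrix (Fin (n i + 1)) (Fin (n i + 1)) K)
      (f : MvPolynomial (MVar v n) K), IsWeightedHomogeneous (wt v n) f a →
        IsWeightedHomogeneous (wt v n) (gAct h f) a := by
    intro h f hf
    rw [← hf.weightedHomogeneousComponent_same, ← weightedHomogeneousComponent_gAct]
    exact weightedHomogeneousComponent_isWeightedHomogeneous a _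
  have : (Submodule.restrictScalars K (Ideal.map (gAct g) I) ⊓
        weightedHomogeneousSubmodule K (wt v n) a : Submodule K (MvPolynomial (MVar v n) K)) =
      Submodule.map (e : MvPolynomial (MVar v n) K →ₗ[K] MvPolynomial (MVar v n) K)
        (Submodule.restrictScalars K I ⊓ weightedHomogeneousSubmodule K (wt v n) a) := by
    ext f
    constructor
    · rintro ⟨h1, h2⟩
      exact ⟨gAct (fun i => (g i)⁻¹) f, ⟨(mem_map_gAct hg).1 h1, hhom _ _ h2⟩,
        gAct_gAct_inv hg f⟩
    · rintro ⟨q, ⟨h1, h2⟩, rfl⟩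
      exact ⟨Ideal.mem_map_of_mem (gAct g) h1, hhom g _ h2⟩
  rw [hilb, hilb, this]
  exact LinearEquiv.finrank_map_eq e _

end Action

section InitialIdeals

variable {K : Type} [Field K] {v : ℕ} {n : Fin v → ℕ}

lemma leadExp_eq_degree (τ : MonomialOrder (MVar v n)) (f : MvPolynomial (MVar v n) K) :
    leadExp τ f = τ.degree f := rfl

/-- The exponents of leading monomials of nonzero elements of `L`. -/
def leadSet (τ : MonomialOrder (MVar v n)) (L : Ideal (MvPolynomial (MVar v n) K)) :
    Set (MVar v n →₀ ℕ) :=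
  {m | ∃ f ∈ L, f ≠ 0 ∧ τ.degree f = m}

lemma hasExponents_inIdeal (τ : MonomialOrder (MVar v n))
    (L : Ideal (MvPolynomial (MVar v n) K)) : HasExponents (inIdeal τ L) (leadSet τ L) := by
  classical
  have h := hasExponents_span (K := K) (leadSet τ L)
  have h1 : inIdeal τ L = Ideal.span ((fun s => monomial s (1 : K)) '' leadSet τ L) := by
    rw [inIdeal]
    congr 1
    ext q
    constructor
    · rintro ⟨f, hf, hf0, rfl⟩
      exact ⟨_, ⟨f, hf, hf0, rfl⟩, rfl⟩
    · rintro ⟨_, ⟨f, hf, hf0, rfl⟩, rfl⟩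
      exact ⟨f, hf, hf0, rfl⟩
  have h2 : {m | ∃ s ∈ leadSet τ L, s ≤ m} = leadSet τ L := by
    ext m
    constructor
    · rintro ⟨_, ⟨f, hf, hf0, rfl⟩, hle⟩
      have hm : monomial (m - τ.degree f) (1 : K) ≠ 0 := by simp
      refine ⟨monomial (m - τ.degree f) 1 * f, Ideal.mul_mem_left _ _ hf, mul_ne_zero hm hf0, ?_⟩
      rw [τ.degree_mul hm hf0, τ.degree_monomial, if_neg one_ne_zero]
      exact tsub_add_cancel_of_le hle
    · exact fun hm => ⟨m, hm, le_rfl⟩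
  rw [h2] at h
  rwa [h1]

lemma linearIndependent_of_degree_injective (τ : MonomialOrder (MVar v n)) {ι : Type*} [Fintype ι]
    {f : ι → MvPolynomial (MVar v n) K} (hf0 : ∀ i, f i ≠ 0)
    (hf : Function.Injective fun i => τ.degree (f i)) : LinearIndependent K f := by
  classical
  rw [Fintype.linearIndependent_iff]
  intro c hc
  by_contra! hne
  obtain ⟨i₀, hi₀⟩ := hne
  obtain ⟨i, hi, hmax⟩ := Finset.exists_max_image (Finset.univ.filter fun i => c i ≠ 0)
    (fun i => τ.toSyn (τ.degree (f i))) ⟨i₀, by simpa using hi₀⟩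
  have hci : c i ≠ 0 := by simpa using hi
  have hcoeff := congrArg (coeff (τ.degree (f i))) hc
  rw [coeff_sum, coeff_zero, Finset.sum_eq_single i, coeff_smul, smul_eq_mul] at hcoeff
  · exact mul_ne_zero hci (τ.coeff_degree_ne_zero_iff.2 (hf0 i)) hcoeff
  · intro j _ hj
    rw [coeff_smul, smul_eq_mul]
    by_cases hcj : c j = 0
    · rw [hcj, zero_mul]
    · rw [τ.coeff_eq_zero_of_lt, mul_zero]
      refine lt_of_le_of_ne (hmax j (by simpa using hcj)) fun h => hj (hf ?_)
      exact τ.toSyn.injective h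
  · simp

lemma IsMultigraded.hilb_eq (τ : MonomialOrder (MVar v n))
    {L : Ideal (MvPolynomial (MVar v n) K)} (hL : IsMultigraded L) (a : Fin v → ℕ) :
    hilb L a = (leadSet τ L ∩ degreeSet v n a).ncard := by
  classical
  set E := leadSet τ L ∩ degreeSet v n a with hE
  have hEfin : E.Finite := (degreeSet_finite a).subset Set.inter_subset_right
  have : Fintype E := hEfin.fintype
  set W : Submodule K (MvPolynomial (MVar v n) K) :=
    Submodule.restrictScalars K L ⊓ weightedHomogeneousSubmodule K (wt v n) a with hW
  have hlead : ∀ f ∈ W, f ≠ 0 → τ.degree f ∈ E := fun f hf hf0 =>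
    ⟨⟨f, hf.1, hf0, rfl⟩, hf.2 (mem_support_iff.1 (τ.degree_mem_support hf0))⟩
  have hex : ∀ e : E, ∃ f : W, (f : MvPolynomial (MVar v n) K) ≠ 0 ∧
      τ.degree (f : MvPolynomial (MVar v n) K) = e := by
    rintro ⟨_, ⟨⟨f, hf, hf0, rfl⟩, hdeg⟩⟩
    have hdeg : Finsupp.weight (wt v n) (τ.degree f) = a := hdeg
    have hsupp := support_weightedHomogeneousComponent (R := K) (w := wt v n) a f
    have hmem : τ.degree f ∈ (weightedHomogeneousComponent (wt v n) a f).support := by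
      rw [hsupp, Finset.mem_filter]
      exact ⟨τ.degree_mem_support hf0, hdeg⟩
    refine ⟨⟨weightedHomogeneousComponent (wt v n) a f, hL f hf a,
      weightedHomogeneousComponent_isWeightedHomogeneous a f⟩, ?_, ?_⟩
    · rintro h0
      have h0 : weightedHomogeneousComponent (wt v n) a f = 0 := h0
      rw [h0] at hmem
      simp at hmem
    · refine τ.toSyn.injective (le_antisymm ?_ (τ.le_degree hmem))
      refine τ.degree_le_degree_of_support_subset ?_
      rw [hsupp]
      exact Finset.filter_subset _ _
  choose F hF0 hF using hex
  let Ψ : W →ₗ[K] (E → K) :=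
    LinearMap.pi fun e => (lcoeff K (e : MVar v n →₀ ℕ)).comp W.subtype
  have hΨ : Function.Injective Ψ := by
    rw [← LinearMap.ker_eq_bot, LinearMap.ker_eq_bot']
    intro f hf
    by_contra hne
    have hne : (f : MvPolynomial (MVar v n) K) ≠ 0 := fun h => hne (Subtype.ext h)
    exact τ.coeff_degree_ne_zero_iff.2 hne (congrFun hf ⟨_, hlead f f.2 hne⟩)
  have hfin : Module.Finite K W := Module.Finite.of_injective Ψ hΨ
  have hli : LinearIndependent K F := by
    refine LinearIndependent.of_comp W.subtype ?_
    refine linearIndependent_of_degree_injective τ hF0 fun e e' h => ?_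
    exact Subtype.ext ((hF e).symm.trans (h.trans (hF e')))
  rw [hilb, ← Nat.card_coe_set_eq, Nat.card_eq_fintype_card]
  refine le_antisymm ?_ hli.fintype_card_le_finrank
  simpa using LinearMap.finrank_le_finrank_of_injective hΨ

lemma sameHS_inIdeal_map (τ : MonomialOrder (MVar v n))
    {g : ∀ i : Fin v, Matrix (Fin (n i + 1)) (Fin (n i + 1)) K}
    (hg : ∀ i, IsUnit (g i).det) {I : Ideal (MvPolynomial (MVar v n) K)}
    (hI : IsMultigraded I) : sameHS (inIdeal τ (Ideal.map (gAct g) I)) I := fun a => by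
  rw [(hasExponents_inIdeal τ _).hilb_eq, ← (hI.map_gAct hg).hilb_eq, hilb_map_gAct hg]

lemma HasExponents.eq_of_le_of_sameHS {I J : Ideal (MvPolynomial (MVar v n) K)}
    {M N : Set (MVar v n →₀ ℕ)} (hI : HasExponents I M) (hJ : HasExponents J N)
    (hMN : M ⊆ N) (h : sameHS I J) : I = J := by
  suffices M = N by
    subst this
    exact hI.congr hJ
  refine hMN.antisymm fun m hm => ?_
  have h1 := h (Finsupp.weight (wt v n) m)
  rw [hI.hilb_eq, hJ.hilb_eq] at h1
  have h2 := Set.eq_of_subset_of_ncard_le (Set.inter_subset_inter_left _ hMN) h1.ge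
    ((degreeSet_finite _).subset Set.inter_subset_right)
  exact (h2.symm.subset ⟨hm, rfl⟩).1

end InitialIdeals

section BorelFixed

variable {K : Type} [Field K] {v : ℕ} {n : Fin v → ℕ}

lemma gAct_mem_varIdeal_initSeg {g : ∀ i : Fin v, Matrix (Fin (n i + 1)) (Fin (n i + 1)) K}
    (hg : ∀ (i : Fin v) (k j : Fin (n i + 1)), j < k → g i k j = 0) (a : Fin v → ℕ)
    {f : MvPolynomial (MVar v n) K} (hf : f ∈ varIdeal K (initSeg v n a)) :
    gAct g f ∈ varIdeal K (initSeg v n a) := by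
  suffices varIdeal K (initSeg v n a) ≤ (varIdeal K (initSeg v n a)).comap (gAct g) from this hf
  refine Ideal.span_le.2 ?_
  rintro _ ⟨x, hx, rfl⟩
  rw [SetLike.mem_coe, Ideal.mem_comap, gAct_X]
  refine Ideal.sum_mem _ fun k _ => ?_
  rcases lt_or_ge x.2 k with h | h
  · rw [hg _ _ _ h, C_0, zero_mul]
    exact Ideal.zero_mem _
  · refine Ideal.mul_mem_left _ _ (X_mem_varIdeal.2 (mem_initSeg.2 ?_))
    exact lt_of_le_of_lt (Fin.le_def.1 h) (mem_initSeg.1 hx)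

lemma gAct_mem_segIdeal {g : ∀ i : Fin v, Matrix (Fin (n i + 1)) (Fin (n i + 1)) K}
    (hg : ∀ (i : Fin v) (k j : Fin (n i + 1)), j < k → g i k j = 0) (A : Set (Fin v → ℕ))
    {f : MvPolynomial (MVar v n) K} (hf : f ∈ segIdeal K n A) : gAct g f ∈ segIdeal K n A := by
  rw [mem_segIdeal] at hf ⊢
  exact fun a ha => gAct_mem_varIdeal_initSeg hg a (hf a ha)

lemma segIdeal_borelFixed (A : Set (Fin v → ℕ)) : BorelFixed (segIdeal K n A) := by
  intro g hdet hg
  have hinv : ∀ (i : Fin v) (k j : Fin (n i + 1)), j < k → (g i)⁻¹ k j = 0 := fun i k j h => by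
    have : Invertible (g i) := Matrix.invertibleOfIsUnitDet _ (hdet i)
    exact Matrix.blockTriangular_inv_of_blockTriangular
      (b := id) (fun k j h => hg i k j h) h
  refine le_antisymm (Ideal.map_le_iff_le_comap.2 fun f hf => gAct_mem_segIdeal hg A hf) ?_
  intro f hf
  rw [mem_map_gAct hdet]
  exact gAct_mem_segIdeal hinv A hf

/-- An ideal stable under all diagonal automorphisms contains the monomials of its elements. -/
lemma monomial_mem_of_diagonal [Infinite K] {J : Ideal (MvPolynomial (MVar v n) K)}
    (hJ : ∀ t : MVar v n → K, (∀ x, t x ≠ 0) → ∀ f ∈ J,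
      gAct (fun i => Matrix.diagonal fun j => t ⟨i, j⟩) f ∈ J)
    {f : MvPolynomial (MVar v n) K} (hf : f ∈ J) {m : MVar v n →₀ ℕ} (hm : m ∈ f.support) :
    monomial m (1 : K) ∈ J := by
  classical
  rw [← Ideal.Quotient.eq_zero_iff_mem, ← Module.forall_dual_apply_eq_zero_iff K]
  intro φ
  set ψ : MvPolynomial (MVar v n) K →ₗ[K] K :=
    φ.comp (Ideal.Quotient.mkₐ K J).toLinearMap with hψ
  have hψJ : ∀ q ∈ J, ψ q = 0 := fun q hq => by
    simp [hψ, Ideal.Quotient.eq_zero_iff_mem.2 hq]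
  have hdiag : ∀ (t : MVar v n → K) (s : MVar v n →₀ ℕ) (c : K),
      gAct (fun i => Matrix.diagonal fun j => t ⟨i, j⟩) (monomial s c) =
        (∏ x, t x ^ s x) • monomial s c := by
    intro t s c
    have hX : ∀ x : MVar v n, gAct (fun i => Matrix.diagonal fun j => t ⟨i, j⟩)
        (X x : MvPolynomial (MVar v n) K) = C (t x) * X x := by
      rintro ⟨i, j⟩
      rw [gAct_X, Finset.sum_eq_single j]
      · simp
      · intro k _ hk
        simp [Matrix.diagonal_apply_ne _ hk]
      · simp
    rw [gAct_monomial]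
    simp_rw [hX, mul_pow, Finset.prod_mul_distrib]
    rw [smul_eq_C_mul, monomial_eq, Finsupp.prod_fintype _ _ (by simp), map_prod]
    simp_rw [map_pow]
    ring
  set P : MvPolynomial (MVar v n) K :=
    ∑ s ∈ f.support, monomial s (coeff s f * ψ (monomial s 1)) with hP
  have hPeval : ∀ t : MVar v n → K, eval t P =
      ψ (gAct (fun i => Matrix.diagonal fun j => t ⟨i, j⟩) f) := by
    intro t
    conv_rhs => rw [f.as_sum]
    rw [hP, map_sum, map_sum, map_sum]
    refine Finset.sum_congr rfl fun s _ => ?_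
    rw [hdiag, eval_monomial, Finsupp.prod_fintype _ _ (by simp), map_smul,
      ← mul_one (coeff s f), ← smul_eq_mul (coeff s f) 1, ← smul_monomial, map_smul]
    simp only [smul_eq_mul, mul_one]
    ring
  have hP0 : P = 0 := by
    have h : P * ∏ x, X x = 0 := by
      refine MvPolynomial.funext fun t => ?_
      rw [map_mul, map_zero, map_prod]
      simp_rw [eval_X]
      by_cases ht : ∀ x, t x ≠ 0
      · rw [hPeval, hψJ _ (hJ t ht f hf), zero_mul]
      · push Not at ht
        obtain ⟨x, hx⟩ := ht
        rw [Finset.prod_eq_zero (Finset.mem_univ x) hx, mul_zero]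
    exact (mul_eq_zero.1 h).resolve_right
      (Finset.prod_ne_zero_iff.2 fun x _ => X_ne_zero x)
  have hc : coeff m P = coeff m f * ψ (monomial m 1) := by
    rw [hP, coeff_sum, Finset.sum_eq_single m]
    · simp
    · intro s _ hs
      rw [coeff_monomial, if_neg hs]
    · exact fun h => absurd hm h
  rw [hP0, coeff_zero] at hc
  exact (mul_eq_zero.1 hc.symm).resolve_left (mem_support_iff.1 hm)

lemma BorelFixed.gAct_mem {J : Ideal (MvPolynomial (MVar v n) K)} (hJ : BorelFixed J)
    {g : ∀ i : Fin v, Matrix (Fin (n i + 1)) (Fin (n i + 1)) K} (hdet : ∀ i, IsUnit (g i).det)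
    (hg : ∀ (i : Fin v) (k j : Fin (n i + 1)), j < k → g i k j = 0)
    {f : MvPolynomial (MVar v n) K} (hf : f ∈ J) : gAct g f ∈ J := by
  rw [← hJ g hdet hg]
  exact Ideal.mem_map_of_mem _ hf

lemma BorelFixed.hasSupports [Infinite K] {J : Ideal (MvPolynomial (MVar v n) K)}
    (hJ : BorelFixed J) (hrad : J.IsRadical) : ∃ U, HasSupports J U := by
  classical
  have hmon : ∀ f ∈ J, ∀ m ∈ f.support, monomial m (1 : K) ∈ J := fun f hf m hm => by
    refine monomial_mem_of_diagonal (fun t ht q hq => ?_) hf hm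
    refine hJ.gAct_mem (fun i => ?_) (fun i k j h => Matrix.diagonal_apply_ne _ h.ne') hq
    rw [Matrix.det_diagonal, isUnit_iff_ne_zero]
    exact Finset.prod_ne_zero_iff.2 fun j _ => ht _
  have hsupp : ∀ m : MVar v n →₀ ℕ, monomial m (1 : K) ∈ J ↔
      monomial (indExp m.support) (1 : K) ∈ J := by
    intro m
    constructor
    · intro h
      refine hrad ⟨∑ x, m x, ?_⟩
      rw [monomial_pow, one_pow]
      have hle : m ≤ (∑ x, m x) • indExp m.support := by
        intro x
        rw [Finsupp.smul_apply, indExp_apply]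
        split_ifs with hx
        · simpa using Finset.single_le_sum (f := m) (fun _ _ => Nat.zero_le _)
            (Finset.mem_univ x)
        · simp [Finsupp.notMem_support_iff.1 hx]
      have := J.mul_mem_left (monomial ((∑ x, m x) • indExp m.support - m) 1) h
      rwa [monomial_mul, one_mul, tsub_add_cancel_of_le hle] at this
    · intro h
      have hle : indExp m.support ≤ m := by
        intro x
        rw [indExp_apply]
        split_ifs with hx
        · exact Nat.one_le_iff_ne_zero.2 (Finsupp.mem_support_iff.1 hx)
        · exact Nat.zero_le _
      have := J.mul_mem_left (monomial (m - indExp m.support) 1) h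
      rwa [monomial_mul, one_mul, tsub_add_cancel_of_le hle] at this
  refine ⟨{F | monomial (indExp F) (1 : K) ∈ J}, fun F G h hF => ?_, fun f => ⟨?_, ?_⟩⟩
  · rw [Set.mem_ofPred_eq, ← prod_X_eq] at hF ⊢
    rw [← Finset.prod_sdiff h]
    exact J.mul_mem_left _ hF
  · exact fun hf m hm => (hsupp m).1 (hmon f hf m hm)
  · intro h
    rw [f.as_sum]
    refine Ideal.sum_mem _ fun m hm => ?_
    rw [← mul_one (coeff m f), ← C_mul_monomial]
    exact J.mul_mem_left _ ((hsupp m).2 (h m hm))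

lemma BorelFixed.erase_mem {J : Ideal (MvPolynomial (MVar v n) K)} {U : Set (Finset (MVar v n))}
    (hU : HasSupports J U) (hJ : BorelFixed J) (hrad : J.IsRadical)
    {F : Finset (MVar v n)} (hF : F ∈ U) {i : Fin v} {j k : Fin (n i + 1)} (hjk : j < k)
    (hj : (⟨i, j⟩ : MVar v n) ∈ F) (hk : (⟨i, k⟩ : MVar v n) ∈ F) [DecidableEq (MVar v n)] :
    F.erase ⟨i, k⟩ ∈ U := by
  set g : ∀ i : Fin v, Matrix (Fin (n i + 1)) (Fin (n i + 1)) K :=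
    Function.update (fun _ => 1) i (Matrix.transvection j k 1) with hgdef
  have hgi : g i = Matrix.transvection j k 1 := Function.update_self ..
  have hgne : ∀ i' ≠ i, g i' = 1 := fun i' h => Function.update_of_ne h ..
  have hdet : ∀ i', IsUnit (g i').det := by
    intro i'
    rcases eq_or_ne i' i with rfl | h
    · rw [hgi, Matrix.det_transvection_of_ne _ _ hjk.ne]
      exact isUnit_one
    · rw [hgne _ h, Matrix.det_one]
      exact isUnit_one
  have hup : ∀ (i' : Fin v) (k' j' : Fin (n i' + 1)), j' < k' → g i' k' j' = 0 := by
    intro i' k' j' hlt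
    rcases eq_or_ne i' i with rfl | h
    · rw [hgi, Matrix.transvection, Matrix.add_apply, Matrix.one_apply_ne hlt.ne', zero_add,
        Matrix.single_apply, if_neg]
      rintro ⟨rfl, rfl⟩
      exact absurd hlt hjk.not_gt
    · rw [hgne _ h, Matrix.one_apply_ne hlt.ne']
  have hX : ∀ x : MVar v n, x ≠ ⟨i, k⟩ → gAct g (X x) = X x := by
    rintro ⟨i', l⟩ hx
    rw [gAct_X, Finset.sum_eq_single l]
    · rcases eq_or_ne i' i with rfl | h
      · have hlk : k ≠ l := fun h => hx (by rw [h])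
        simp [hgi, Matrix.transvection, hlk]
      · simp [hgne _ h]
    · intro b _ hb
      rcases eq_or_ne i' i with rfl | h
      · have hlk : k ≠ l := fun h => hx (by rw [h])
        simp [hgi, Matrix.transvection, hlk, Matrix.one_apply_ne hb]
      · simp [hgne _ h, Matrix.one_apply_ne hb]
    · simp
  have hXk : gAct g (X ⟨i, k⟩) = X ⟨i, k⟩ + X ⟨i, j⟩ := by
    rw [gAct_X]
    simp only [hgi, Matrix.transvection, Matrix.add_apply, C_add, add_mul,
      Finset.sum_add_distrib]
    congr 1
    · rw [Finset.sum_eq_single k]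
      · simp
      · intro b _ hb
        simp [Matrix.one_apply_ne hb]
      · simp
    · rw [Finset.sum_eq_single j]
      · simp
      · intro b _ hb
        simp [hb.symm]
      · simp
  set E := F.erase ⟨i, k⟩ with hE
  have hprod : ∏ x ∈ F, (X x : MvPolynomial (MVar v n) K) = X ⟨i, k⟩ * ∏ x ∈ E, X x :=
    (Finset.mul_prod_erase F _ hk).symm
  have h1 := hJ.gAct_mem hdet hup ((hU.prod_mem F).2 hF)
  have h0 := (hU.prod_mem F).2 hF
  rw [hprod, map_mul, map_prod, Finset.prod_congr rfl fun x hx => hX x (Finset.ne_of_mem_erase hx),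
    hXk] at h1
  rw [hprod] at h0
  have h2 : X ⟨i, j⟩ * ∏ x ∈ E, (X x : MvPolynomial (MVar v n) K) ∈ J := by
    convert J.sub_mem h1 h0 using 1
    ring
  rw [← hU.prod_mem]
  refine hrad ⟨2, ?_⟩
  have hjE : (⟨i, j⟩ : MVar v n) ∈ E := Finset.mem_erase.2 ⟨fun h => hjk.ne (by simpa using h), hj⟩
  convert J.mul_mem_left (∏ x ∈ E.erase ⟨i, j⟩, X x) h2 using 1
  rw [← mul_assoc, mul_comm (∏ x ∈ E.erase _, _), Finset.mul_prod_erase E _ hjE]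
  ring

end BorelFixed

section Duality

variable {K : Type} [Field K] {v : ℕ} {n : Fin v → ℕ}

lemma eq_initSeg_rowCount {F : Finset (MVar v n)}
    (hF : ∀ (i : Fin v) (j k : Fin (n i + 1)), j < k → (⟨i, k⟩ : MVar v n) ∈ F →
      (⟨i, j⟩ : MVar v n) ∈ F) : F = initSeg v n (rowCount v n F) := by
  classical
  ext ⟨i, j⟩
  rw [mem_initSeg, rowCount]
  constructor
  · intro hj
    have : (Finset.Iic j).map ⟨Sigma.mk i, sigma_mk_injective⟩ ⊆ F.filter fun x => x.1 = i := by
      intro x hx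
      obtain ⟨l, hl, rfl⟩ := Finset.mem_map.1 hx
      refine Finset.mem_filter.2 ⟨?_, rfl⟩
      rcases (Finset.mem_Iic.1 hl).eq_or_lt with rfl | h
      · exact hj
      · exact hF i l j h hj
    have := Finset.card_le_card this
    rw [Finset.card_map, Fin.card_Iic] at this
    exact this
  · intro hlt
    by_contra hj
    have : (F.filter fun x => x.1 = i) ⊆
        (Finset.Iio j).map ⟨Sigma.mk i, sigma_mk_injective⟩ := by
      rintro ⟨i', l⟩ hx
      obtain ⟨hlF, hi⟩ := Finset.mem_filter.1 hx
      obtain rfl : i' = i := hi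
      refine Finset.mem_map.2 ⟨l, Finset.mem_Iio.2 ?_, rfl⟩
      by_contra hl
      rcases (not_lt.1 hl).eq_or_lt with h | h
      · exact hj (h ▸ hlF)
      · exact hj (hF _ _ _ h hlF)
    have := Finset.card_le_card this
    rw [Finset.card_map, Fin.card_Iio] at this
    exact absurd hlt this.not_gt

lemma dualSupports_eq_initSeg {U : Set (Finset (MVar v n))} (hU : IsUpperSet U)
    (hex : ∀ F ∈ U, ∀ (i : Fin v) (j k : Fin (n i + 1)), j < k → (⟨i, j⟩ : MVar v n) ∈ F →
      (⟨i, k⟩ : MVar v n) ∈ F → F.erase ⟨i, k⟩ ∈ U) :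
    ∃ A : Set (Fin v → ℕ), (∀ a ∈ A, ∀ i, a i ≤ n i + 1) ∧
      dualSupports U = {G | ∃ a ∈ A, initSeg v n a ⊆ G} := by
  classical
  refine ⟨{a | initSeg v n a ∈ dualSupports U ∧ ∀ i, a i ≤ n i + 1}, fun a ha => ha.2, ?_⟩
  refine Set.Subset.antisymm (fun F hF => ?_) fun F ⟨a, ha, h⟩ =>
    isUpperSet_dualSupports hU h ha.1
  obtain ⟨G, hGF, hG⟩ := (Set.toFinite (dualSupports U)).exists_le_minimal hF
  have hseg : G = initSeg v n (rowCount v n G) := by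
    refine eq_initSeg_rowCount fun i j k hjk hk => ?_
    by_contra hj
    have h1 : G.erase ⟨i, k⟩ ∉ dualSupports U := fun h =>
      (Finset.erase_ssubset hk).not_ge (hG.2 h (Finset.erase_subset _ _))
    have h2 : (G.erase ⟨i, k⟩)ᶜ ∈ U := not_not.1 h1
    have h3 := hex _ h2 i j k hjk (by simp [hj]) (by simp)
    refine hG.1 (?_ : Gᶜ ∈ U)
    convert h3 using 1
    ext x
    by_cases hx : x = ⟨i, k⟩ <;> simp [hx, hk]
  exact ⟨rowCount v n G, ⟨hseg ▸ hG.1, rowCount_le G⟩, hseg ▸ hGF⟩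

lemma HasExponents.hilb_ne_zero_iff {I : Ideal (MvPolynomial (MVar v n) K)}
    {M : Set (MVar v n →₀ ℕ)} (hI : HasExponents I M) (b : Fin v → ℕ) :
    hilb I b ≠ 0 ↔ ∃ m ∈ M, Finsupp.weight (wt v n) m = b := by
  rw [hI.hilb_eq, ← Nat.pos_iff_ne_zero, Set.ncard_pos
    ((degreeSet_finite b).subset Set.inter_subset_right)]
  rfl

lemma HasSupports.hilb_ne_zero_iff {I : Ideal (MvPolynomial (MVar v n) K)}
    {U : Set (Finset (MVar v n))} (hI : HasSupports I U) (b : Fin v → ℕ) :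
    hilb I b ≠ 0 ↔ ∃ F ∈ U, rowCount v n F ≤ b := by
  classical
  rw [hI.2.hilb_ne_zero_iff]
  constructor
  · rintro ⟨m, hm, rfl⟩
    exact ⟨m.support, hm, support_subset_weight m⟩
  · rintro ⟨F, hF, h⟩
    refine ⟨indExp F + Tmono v n (b - rowCount v n F), hI.1 ?_ hF, ?_⟩
    · intro x hx
      rw [Finsupp.mem_support_iff, Finsupp.add_apply, indExp_apply, if_pos hx]
      omega
    · rw [map_add, weight_indExp, weight_Tmono, add_tsub_cancel_of_le h]

lemma hilb_Tmono_ne_zero_iff (A : Set (Fin v → ℕ)) (b : Fin v → ℕ) :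
    hilb (Ideal.span ((fun a => monomial (Tmono v n a) (1 : K)) '' A)) b ≠ 0 ↔
      ∃ a ∈ A, a ≤ b := by
  rw [(hasExponents_Tmono A).hilb_ne_zero_iff]
  constructor
  · rintro ⟨m, ⟨a, ha, h⟩, rfl⟩
    refine ⟨a, ha, fun i => (h i).trans ?_⟩
    rw [weight_wt_apply]
    exact Finset.single_le_sum (f := fun j => m ⟨i, j⟩) (fun _ _ => Nat.zero_le _)
      (Finset.mem_univ 0)
  · rintro ⟨a, ha, h⟩
    refine ⟨Tmono v n b, ⟨a, ha, fun i => ?_⟩, weight_Tmono b⟩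
    rw [Tmono_apply_zero]
    exact h i

lemma ExtendedFromT.eq_span_rowCount {I C : Ideal (MvPolynomial (MVar v n) K)}
    {U : Set (Finset (MVar v n))} (hI : HasSupports I U) (hC : ExtendedFromT C)
    (h : sameHS I C) :
    C = Ideal.span ((fun a => monomial (Tmono v n a) (1 : K)) '' (rowCount v n '' U)) := by
  obtain ⟨A, rfl⟩ := hC
  have key : ∀ b, (∃ a ∈ A, a ≤ b) ↔ ∃ a ∈ rowCount v n '' U, a ≤ b := fun b => by
    rw [← hilb_Tmono_ne_zero_iff (K := K), ← h b, hI.hilb_ne_zero_iff, Set.exists_mem_image]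
  refine (hasExponents_Tmono A).congr ?_
  convert hasExponents_Tmono (K := K) (rowCount v n '' U) using 1
  ext m
  exact key fun i => m ⟨i, 0⟩

lemma IsCS.isCSstar_dual [Infinite K] {I J : Ideal (MvPolynomial (MVar v n) K)}
    {U : Set (Finset (MVar v n))} (hI : HasSupports I U) (hJ : HasSupports J (dualSupports U))
    (h : IsCS I) : IsCSstar J := by
  classical
  obtain ⟨-, L, hrad, hL, hIL⟩ := h
  obtain ⟨V, hV⟩ := hL.hasSupports hrad
  obtain ⟨A, hA, hAV⟩ := dualSupports_eq_initSeg hV.1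
    fun F hF i j k hjk hj hk => hL.erase_mem hV hrad hF hjk hj hk
  have hP := hasSupports_pol (K := K) (n := n) A
  rw [← hAV] at hP
  exact ⟨hJ.2.isMultigraded, _, ⟨A, rfl⟩, fun a =>
    (hI.sameHS_dual hV hJ hP hIL a).trans (sameHS_polarization hA a)⟩

/-- The radical Borel fixed ideal associated with the dual of a Cartwright-Sturmfels* ideal. -/
lemma IsCSstar.sameHS_segIdeal {I J : Ideal (MvPolynomial (MVar v n) K)}
    {U : Set (Finset (MVar v n))} (hI : HasSupports I U) (hJ : HasSupports J (dualSupports U))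
    (h : IsCSstar J) : sameHS I (segIdeal K n (rowCount v n '' dualSupports U)) := by
  obtain ⟨-, C, hC, hJC⟩ := h
  have hA : ∀ a ∈ rowCount v n '' dualSupports U, ∀ i, a i ≤ n i + 1 := by
    rintro _ ⟨F, -, rfl⟩
    exact rowCount_le F
  have hCeq := hC.eq_span_rowCount hJ hJC
  have hP := hasSupports_pol (K := K) (n := n) (rowCount v n '' dualSupports U)
  refine hJ.sameHS_dual hP ?_ (hasSupports_segIdeal _) fun a => ?_
  · rwa [dualSupports_dualSupports]
  · rw [hJC a, hCeq, sameHS_polarization hA a]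

end Duality

section Genericity

variable {K : Type} [Field K] {v : ℕ} {n : Fin v → ℕ}

lemma Generically.and
    {P Q : (∀ i : Fin v, Matrix (Fin (n i + 1)) (Fin (n i + 1)) K) → Prop}
    (hP : Generically P) (hQ : Generically Q) : Generically fun g => P g ∧ Q g := by
  obtain ⟨p, hp, hp'⟩ := hP
  obtain ⟨q, hq, hq'⟩ := hQ
  refine ⟨p * q, mul_ne_zero hp hq, fun g hg h => ?_⟩
  rw [map_mul] at h
  exact ⟨hp' g hg (left_ne_zero_of_mul h), hq' g hg (right_ne_zero_of_mul h)⟩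

lemma Generically.forall_finite {ι : Type*} [Finite ι]
    {P : ι → (∀ i : Fin v, Matrix (Fin (n i + 1)) (Fin (n i + 1)) K) → Prop}
    (hP : ∀ k, Generically (P k)) : Generically fun g => ∀ k, P k g := by
  have := Fintype.ofFinite ι
  choose p hp hp' using hP
  refine ⟨∏ k, p k, Finset.prod_ne_zero_iff.2 fun k _ => hp k, fun g hg h k => hp' k g hg ?_⟩
  rw [map_prod] at h
  exact Finset.prod_ne_zero_iff.1 h k (Finset.mem_univ k)

/-- The minor of the `i`-th matrix with rows `r` and columns `e`, as a polynomial in the entries. -/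
lemma exists_minor_polynomial (i : Fin v) {c : ℕ} {r e : Fin c → Fin (n i + 1)}
    (hr : r.Injective) (he : e.Injective) :
    ∃ p : MvPolynomial (Σ i : Fin v, Fin (n i + 1) × Fin (n i + 1)) K, p ≠ 0 ∧
      ∀ g : ∀ i : Fin v, Matrix (Fin (n i + 1)) (Fin (n i + 1)) K,
        eval (fun q : Σ i : Fin v, Fin (n i + 1) × Fin (n i + 1) => g q.1 q.2.1 q.2.2) p =
          ((g i).submatrix r e).det := by
  set φ : Fin c × Fin c → Σ i : Fin v, Fin (n i + 1) × Fin (n i + 1) :=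
    fun p => ⟨i, (r p.1, e p.2)⟩ with hφ
  have hinj : φ.Injective := fun p q h => by
    have h := sigma_mk_injective h
    rw [Prod.mk.injEq] at h
    exact Prod.ext (hr h.1) (he h.2)
  refine ⟨rename φ (Matrix.mvPolynomialX (Fin c) (Fin c) K).det, fun h => ?_, fun g => ?_⟩
  · rw [← map_zero (rename φ : MvPolynomial (Fin c × Fin c) K →ₐ[K] _)] at h
    exact Matrix.det_mvPolynomialX_ne_zero (Fin c) K (rename_injective φ hinj h)
  · rw [eval_rename, RingHom.map_det]
    congr 1
    exact Matrix.mvPolynomialX_mapMatrix_eval ((g i).submatrix r e)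

lemma generically_minor_ne_zero (i : Fin v) {c : ℕ} {r e : Fin c → Fin (n i + 1)}
    (hr : r.Injective) (he : e.Injective) :
    Generically fun g : ∀ i : Fin v, Matrix (Fin (n i + 1)) (Fin (n i + 1)) K =>
      ((g i).submatrix r e).det ≠ 0 := by
  obtain ⟨p, hp, h⟩ := exists_minor_polynomial (K := K) i hr he
  exact ⟨p, hp, fun g _ hg => by rwa [h g] at hg⟩

lemma Generically.exists_isUnit_det [Infinite K]
    {P : (∀ i : Fin v, Matrix (Fin (n i + 1)) (Fin (n i + 1)) K) → Prop} (hP : Generically P) :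
    ∃ g : ∀ i : Fin v, Matrix (Fin (n i + 1)) (Fin (n i + 1)) K,
      (∀ i, IsUnit (g i).det) ∧ P g := by
  obtain ⟨p, hp, hP⟩ := hP
  choose q hq hq' using fun i : Fin v =>
    exists_minor_polynomial (K := K) (n := n) i Function.injective_id Function.injective_id
  have hne : p * ∏ i, q i ≠ 0 :=
    mul_ne_zero hp (Finset.prod_ne_zero_iff.2 fun i _ => hq i)
  obtain ⟨x, hx⟩ : ∃ x, eval x (p * ∏ i, q i) ≠ 0 := by
    by_contra! h
    exact hne (MvPolynomial.funext fun x => by rw [h, map_zero])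
  rw [map_mul, map_prod] at hx
  set g : ∀ i : Fin v, Matrix (Fin (n i + 1)) (Fin (n i + 1)) K :=
    fun i => Matrix.of fun a b => x ⟨i, (a, b)⟩ with hg
  have hgx : x = fun q : Σ i : Fin v, Fin (n i + 1) × Fin (n i + 1) => g q.1 q.2.1 q.2.2 := rfl
  have hdet : ∀ i, IsUnit (g i).det := fun i => by
    have h := Finset.prod_ne_zero_iff.1 (right_ne_zero_of_mul hx) i (Finset.mem_univ i)
    rw [hgx, hq', Matrix.submatrix_id_id] at h
    exact h.isUnit
  refine ⟨g, hdet, hP g hdet (left_ne_zero_of_mul hx)⟩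

end Genericity

section GinStar

variable {K : Type} [Field K] {v : ℕ} {n : Fin v → ℕ}

lemma single_le_of_respectsVarOrder {τ : MonomialOrder (MVar v n)} (hτ : RespectsVarOrder τ)
    {i : Fin v} {j k : Fin (n i + 1)} (h : j ≤ k) :
    τ.toSyn (Finsupp.single (⟨i, k⟩ : MVar v n) 1) ≤
      τ.toSyn (Finsupp.single (⟨i, j⟩ : MVar v n) 1) := by
  rcases h.eq_or_lt with rfl | h
  · exact le_rfl
  · exact (hτ i j k h).le

lemma degree_linear_le (τ : MonomialOrder (MVar v n)) (i : Fin v) (c : Fin (n i + 1) → K)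
    {d : MVar v n →₀ ℕ}
    (hd : ∀ k, c k ≠ 0 → τ.toSyn (Finsupp.single (⟨i, k⟩ : MVar v n) 1) ≤ τ.toSyn d) :
    τ.toSyn (τ.degree (∑ k, C (c k) * X (⟨i, k⟩ : MVar v n) : MvPolynomial (MVar v n) K)) ≤
      τ.toSyn d := by
  classical
  rw [τ.degree_le_iff]
  intro m hm
  rw [mem_support_iff, coeff_sum] at hm
  obtain ⟨k, -, hk⟩ := Finset.exists_ne_zero_of_sum_ne_zero hm
  rw [coeff_C_mul, coeff_X] at hk
  rw [← show _ = m from not_not.1 fun h => hk (by rw [if_neg h, mul_zero])]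
  exact hd k (left_ne_zero_of_mul hk)

lemma degree_linear {τ : MonomialOrder (MVar v n)} (hτ : RespectsVarOrder τ) (i : Fin v)
    (c : Fin (n i + 1) → K) (hc : c 0 ≠ 0) :
    τ.degree (∑ k, C (c k) * X (⟨i, k⟩ : MVar v n) : MvPolynomial (MVar v n) K) =
      Finsupp.single (⟨i, 0⟩ : MVar v n) 1 := by
  classical
  refine τ.toSyn.injective (le_antisymm ?_ (τ.le_degree ?_))
  · exact degree_linear_le τ i c fun k _ => single_le_of_respectsVarOrder hτ (Fin.zero_le k)
  · rw [mem_support_iff, coeff_sum, Finset.sum_eq_single 0]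
    · rwa [coeff_C_mul, coeff_X, if_pos rfl, mul_one]
    · intro k _ hk
      rw [coeff_C_mul, coeff_X, if_neg, mul_zero]
      intro h
      exact hk (by simpa using (Finsupp.single_left_injective one_ne_zero) h)
    · simp

lemma sum_single_zero_eq_Tmono (F : Finset (MVar v n)) :
    ∑ x ∈ F, Finsupp.single (⟨x.1, 0⟩ : MVar v n) 1 = Tmono v n (rowCount v n F) := by
  classical
  rw [← Finset.sum_fiberwise (s := F) (g := Sigma.fst), Tmono]
  refine Finset.sum_congr rfl fun i _ => ?_
  rw [Finset.sum_congr rfl (g := fun _ => Finsupp.single (⟨i, 0⟩ : MVar v n) 1)]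
  · rw [Finset.sum_const, Finsupp.smul_single, smul_eq_mul, mul_one, rowCount]
  · rintro x hx
    rw [(Finset.mem_filter.1 hx).2]

lemma generically_top_row_ne_zero :
    Generically fun g : ∀ i : Fin v, Matrix (Fin (n i + 1)) (Fin (n i + 1)) K =>
      ∀ x : MVar v n, g x.1 0 x.2 ≠ 0 :=
  Generically.forall_finite fun x => ⟨X ⟨x.1, (0, x.2)⟩, X_ne_zero _, fun g _ h => by simpa using h⟩

lemma IsGin.eq_span_rowCount [Infinite K] {τ : MonomialOrder (MVar v n)}
    (hτ : RespectsVarOrder τ) {J C : Ideal (MvPolynomial (MVar v n) K)}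
    {U : Set (Finset (MVar v n))} (hJ : HasSupports J U) (h : IsCSstar J) (hC : IsGin τ J C) :
    C = Ideal.span ((fun a => monomial (Tmono v n a) (1 : K)) '' (rowCount v n '' U)) := by
  obtain ⟨-, C₀, hC₀, hJC₀⟩ := h
  rw [← hC₀.eq_span_rowCount hJ hJC₀]
  obtain ⟨g, hg, rfl, htop⟩ := (Generically.and hC generically_top_row_ne_zero).exists_isUnit_det
  have hle : C₀ ≤ inIdeal τ (Ideal.map (gAct g) J) := by
    rw [hC₀.eq_span_rowCount hJ hJC₀, Ideal.span_le]
    rintro _ ⟨_, ⟨F, hF, rfl⟩, rfl⟩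
    refine Ideal.subset_span ⟨gAct g (∏ x ∈ F, X x),
      Ideal.mem_map_of_mem _ ((hJ.prod_mem F).2 hF), ?_⟩
    have hdeg : ∀ x : MVar v n, τ.degree (gAct g (X x)) = Finsupp.single ⟨x.1, 0⟩ 1 := fun x => by
      rw [gAct_X]
      exact degree_linear hτ x.1 (fun k => g x.1 k x.2) (htop x)
    have hne : ∀ x : MVar v n, gAct g (X x) ≠ 0 := fun x =>
      τ.ne_zero_of_degree_ne_zero (by simp [hdeg])
    rw [map_prod, leadExp_eq_degree, τ.degree_prod fun x _ => hne x]
    refine ⟨Finset.prod_ne_zero_iff.2 fun x _ => hne x, ?_⟩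
    simp_rw [hdeg, sum_single_zero_eq_Tmono]
  have hC₀e := hasExponents_Tmono (K := K) (n := n) (rowCount v n '' U)
  rw [← hC₀.eq_span_rowCount hJ hJC₀] at hC₀e
  have hin := hasExponents_inIdeal τ (Ideal.map (gAct g) J)
  refine (hC₀e.eq_of_le_of_sameHS hin (fun m hm => ?_) fun a => ?_).symm
  · exact (hin.monomial_mem m).1 (hle ((hC₀e.monomial_mem m).2 hm))
  · rw [← hJC₀ a, sameHS_inIdeal_map τ hg hJ.2.isMultigraded a]

end GinStar

section GinRadical

variable {K : Type} [Field K] {v : ℕ} {n : Fin v → ℕ}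

/-- If the top minor of `M` on the columns in `s` is nonzero, the first rows can be used to
eliminate these columns from the remaining ones. -/
lemma exists_elimination {N : ℕ} (M : Matrix (Fin N) (Fin N) K) (s : Finset (Fin N)) {c : ℕ}
    (hc : s.card = c) (hcN : c ≤ N)
    (hM : (M.submatrix (Fin.castLE hcN) (s.orderEmbOfFin hc)).det ≠ 0) :
    ∃ S : Matrix (Fin N) (Fin N) K, (∀ l k : Fin N, (l : ℕ) < c → S l k = 0) ∧
      (∀ l k : Fin N, c ≤ (k : ℕ) → S l k = if l = k then 1 else 0) ∧
      ∀ l, ∀ j ∈ s, (S * M) l j = 0 := by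
  set G := M.submatrix (Fin.castLE hcN) (s.orderEmbOfFin hc) with hG
  have hsurj : ∀ w : Fin c → K, ∃ b : Fin c → K, Matrix.vecMul b G = w :=
    Matrix.vecMul_surjective_iff_isUnit.2 ((Matrix.isUnit_iff_isUnit_det G).2 hM.isUnit)
  choose b hb using fun l : Fin N => hsurj fun p => -M l (s.orderEmbOfFin hc p)
  refine ⟨Matrix.of fun l k => if hk : (k : ℕ) < c then
    (if (l : ℕ) < c then 0 else b l ⟨k, hk⟩) else if l = k then 1 else 0, ?_, ?_, ?_⟩
  · intro l k hl
    rw [Matrix.of_apply]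
    split_ifs with h1 h2
    · rfl
    · exact absurd (h2 ▸ hl) h1
    · rfl
  · intro l k hk
    rw [Matrix.of_apply, dif_neg hk.not_gt]
  · intro l j hj
    obtain ⟨p, rfl⟩ : ∃ p, s.orderEmbOfFin hc p = j := by
      have : j ∈ Set.range (s.orderEmbOfFin hc) := by simpa using hj
      exact this
    rw [Matrix.mul_apply]
    by_cases hl : (l : ℕ) < c
    · refine Finset.sum_eq_zero fun k _ => ?_
      rw [Matrix.of_apply]
      split_ifs with h1 h2
      · rw [zero_mul]
      · exact absurd (h2 ▸ hl) h1
      · rw [zero_mul]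
    · have hsplit : ∀ k : Fin N, (Matrix.of (fun l k : Fin N => if hk : (k : ℕ) < c then
          (if (l : ℕ) < c then 0 else b l ⟨k, hk⟩) else if l = k then (1 : K) else 0) l k) *
            M k (s.orderEmbOfFin hc p) =
          (if hk : (k : ℕ) < c then b l ⟨k, hk⟩ * M k (s.orderEmbOfFin hc p) else 0) +
          if l = k then M k (s.orderEmbOfFin hc p) else 0 := by
        intro k
        rw [Matrix.of_apply]
        by_cases hk : (k : ℕ) < c
        · have hlk : l ≠ k := fun h => hl (h ▸ hk)
          simp [hk, hl, hlk]
        · simp [hk]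
      rw [Finset.sum_congr rfl fun k _ => hsplit k, Finset.sum_add_distrib,
        Finset.sum_ite_eq, if_pos (Finset.mem_univ l)]
      rw [← Fintype.sum_of_injective (Fin.castLE hcN) (Fin.castLE_injective hcN)
        (fun k => b l k * M (Fin.castLE hcN k) (s.orderEmbOfFin hc p))]
      · have := congrFun (hb l) p
        rw [Matrix.vecMul, dotProduct] at this
        simp only [hG, Matrix.submatrix_apply] at this
        rw [this, neg_add_cancel]
      · intro k hk
        rw [dif_neg]
        exact fun h => hk ⟨⟨k, h⟩, rfl⟩
      · intro k
        rw [dif_pos (show ((Fin.castLE hcN k : Fin N) : ℕ) < c from k.2)]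
        rfl

/-- The columns of the variables of `F` in row `i`. -/
def rowSet (F : Finset (MVar v n)) (i : Fin v) : Finset (Fin (n i + 1)) :=
  Finset.univ.filter fun j => (⟨i, j⟩ : MVar v n) ∈ F

lemma card_rowSet (F : Finset (MVar v n)) (i : Fin v) : (rowSet F i).card = rowCount v n F i := by
  classical
  rw [rowCount_eq_sum, ← Finset.card_filter]
  rfl

/-- The minor of `g` with top rows and the columns of `F` in row `i`. -/
def rowMinor (F : Finset (MVar v n)) (g : ∀ i : Fin v, Matrix (Fin (n i + 1)) (Fin (n i + 1)) K)
    (i : Fin v) : K :=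
  ((g i).submatrix (Fin.castLE (rowCount_le F i))
    ((rowSet F i).orderEmbOfFin (card_rowSet F i))).det

lemma generically_rowMinor_ne_zero :
    Generically fun g : ∀ i : Fin v, Matrix (Fin (n i + 1)) (Fin (n i + 1)) K =>
      ∀ (F : Finset (MVar v n)) (i : Fin v), rowMinor F g i ≠ 0 :=
  Generically.forall_finite fun _ => Generically.forall_finite fun i =>
    generically_minor_ne_zero i (Fin.castLE_injective _) (RelEmbedding.injective _)

lemma degree_gAct_monomial_le (τ : MonomialOrder (MVar v n))
    {S : ∀ i : Fin v, Matrix (Fin (n i + 1)) (Fin (n i + 1)) K}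
    (hS : ∀ x : MVar v n, τ.toSyn (τ.degree (gAct S (X x))) ≤ τ.toSyn (Finsupp.single x 1))
    (m : MVar v n →₀ ℕ) (c : K) :
    τ.toSyn (τ.degree (gAct S (monomial m c))) ≤ τ.toSyn m := by
  classical
  rw [gAct_monomial, C_mul']
  refine τ.degree_smul_le.trans (τ.degree_prod_le.trans ?_)
  conv_rhs => rw [← Finsupp.univ_sum_single m]
  rw [map_sum, map_sum]
  refine Finset.sum_le_sum fun x _ => (τ.degree_pow_le _).trans ?_
  rw [map_nsmul, ← mul_one (m x), ← smul_eq_mul (m x) 1, ← Finsupp.smul_single, map_nsmul]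
  simp only [smul_eq_mul, mul_one]
  exact nsmul_le_nsmul_right (hS x) _

lemma degree_not_disjoint_initSeg {τ : MonomialOrder (MVar v n)} (hτ : RespectsVarOrder τ)
    {g : ∀ i : Fin v, Matrix (Fin (n i + 1)) (Fin (n i + 1)) K} (F : Finset (MVar v n))
    (hg : ∀ i, rowMinor F g i ≠ 0) {f : MvPolynomial (MVar v n) K}
    (hf : f ∈ Ideal.map (gAct g) (varIdeal K F)) (hf0 : f ≠ 0) :
    ∃ x ∈ initSeg v n (rowCount v n F), τ.degree f x ≠ 0 := by
  classical
  choose S hS1 hS2 hS3 using fun i =>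
    exists_elimination (g i) (rowSet F i) (card_rowSet F i) (rowCount_le F i) (hg i)
  have hkill : gAct S f = 0 := by
    suffices Ideal.map (gAct g) (varIdeal K F) ≤ RingHom.ker (gAct S) from this hf
    rw [Ideal.map_le_iff_le_comap, varIdeal, Ideal.span_le]
    rintro _ ⟨x, hx, rfl⟩
    rw [SetLike.mem_coe, Ideal.mem_comap, RingHom.mem_ker, gAct_gAct, gAct_X]
    refine Finset.sum_eq_zero fun l _ => ?_
    rw [hS3 x.1 l x.2 (Finset.mem_filter.2 ⟨Finset.mem_univ _, hx⟩), C_0, zero_mul]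
  have hfix : ∀ x ∉ initSeg v n (rowCount v n F), gAct S (X x) = X x := by
    intro x hx
    rw [mem_initSeg, not_lt] at hx
    rw [gAct_X, Finset.sum_eq_single x.2]
    · rw [hS2 _ _ _ hx, if_pos rfl, C_1, one_mul]
    · intro k _ hk
      rw [hS2 _ _ _ hx, if_neg hk, C_0, zero_mul]
    · simp
  have hdeg : ∀ x : MVar v n, τ.toSyn (τ.degree (gAct S (X x))) ≤
      τ.toSyn (Finsupp.single x 1) := by
    intro x
    by_cases hx : x ∈ initSeg v n (rowCount v n F)
    · rw [gAct_X]
      refine degree_linear_le τ x.1 (fun k => S x.1 k x.2) fun k hk => ?_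
      refine single_le_of_respectsVarOrder (j := x.2) hτ ?_
      have h : ¬ (k : ℕ) < rowCount v n F x.1 := fun h => hk (hS1 _ _ _ h)
      exact Fin.le_def.2 ((mem_initSeg.1 hx).le.trans (not_lt.1 h))
    · rw [hfix x hx, τ.degree_X]
  by_contra! hd
  refine τ.coeff_degree_ne_zero_iff.2 hf0 ?_
  set d := τ.degree f with hdef
  have h1 : gAct S (monomial d (coeff d f)) = monomial d (coeff d f) := by
    rw [gAct_monomial, monomial_eq, Finsupp.prod_fintype _ _ (by simp)]
    congr 1
    refine Finset.prod_congr rfl fun x _ => ?_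
    by_cases hx : x ∈ initSeg v n (rowCount v n F)
    · rw [hd x hx, pow_zero, pow_zero]
    · rw [hfix x hx]
  have h2 : coeff d (gAct S f) = coeff d f := by
    conv_lhs => rw [f.as_sum]
    rw [map_sum, coeff_sum, Finset.sum_eq_single d]
    · rw [h1, coeff_monomial, if_pos rfl]
    · intro m hm hne
      refine τ.coeff_eq_zero_of_lt ((degree_gAct_monomial_le τ hdeg m _).trans_lt ?_)
      exact lt_of_le_of_ne (τ.le_degree hm) fun h => hne (τ.toSyn.injective h)
    · intro h
      rw [notMem_support_iff.1 h, monomial_zero, map_zero, coeff_zero]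
  rw [← h2, hkill, coeff_zero]

lemma IsGin.eq_segIdeal [Infinite K] {τ : MonomialOrder (MVar v n)}
    (hτ : RespectsVarOrder τ) {I B : Ideal (MvPolynomial (MVar v n) K)}
    {U : Set (Finset (MVar v n))} (hI : HasSupports I U)
    (h : sameHS I (segIdeal K n (rowCount v n '' dualSupports U))) (hB : IsGin τ I B) :
    B = segIdeal K n (rowCount v n '' dualSupports U) := by
  obtain ⟨g, hg, rfl, hminor⟩ := (Generically.and hB generically_rowMinor_ne_zero).exists_isUnit_det
  refine (hasExponents_inIdeal τ _).eq_of_le_of_sameHS (hasSupports_segIdeal _).2 ?_ fun a => ?_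
  · rintro _ ⟨f, hf, hf0, rfl⟩
    rw [← (hasSupports_segIdeal (K := K) _).2.monomial_mem, mem_segIdeal]
    rintro _ ⟨F, hF, rfl⟩
    have hfF : f ∈ Ideal.map (gAct g) (varIdeal K F) :=
      Ideal.map_mono ((hI.le_varIdeal_iff F).2 hF) hf
    obtain ⟨x, hx, hne⟩ := degree_not_disjoint_initSeg hτ F (hminor F) hfF hf0
    rw [mem_varIdeal]
    intro m hm
    classical
    rw [support_monomial, if_neg one_ne_zero, Finset.mem_singleton] at hm
    exact ⟨x, hx, hm ▸ hne⟩
  · rw [sameHS_inIdeal_map τ hg hI.2.isMultigraded a, h a]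

end GinRadical

end CSPaper

/-- **Duality theorem.** A squarefree monomial ideal `I` of `S` is Cartwright-Sturmfels iff
its Alexander dual `I*` is Cartwright-Sturmfels*.  Moreover if `I` is Cartwright-Sturmfels
then `gin(I)* = pol(gin(I*))`: the Alexander dual of the generic initial ideal of `I` is
the polarization of the generic initial ideal of `I*`. -/
theorem CS_iff_dual_CSstar
    {K : Type} [Field K] [Infinite K] {v : ℕ} {n : Fin v → ℕ}
    (I Istar : Ideal (MvPolynomial (MVar v n) K))
    (hI : IsSqfreeMonomialIdeal I) (hdual : IsAlexanderDual I Istar) :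
    (IsCS I ↔ IsCSstar Istar) ∧
    (IsCS I →
      ∀ τ σ' : MonomialOrder (MVar v n), RespectsVarOrder τ → RespectsVarOrder σ' →
      ∀ B C D : Ideal (MvPolynomial (MVar v n) K),
        IsGin τ I B → IsGin σ' Istar C → IsAlexanderDual B D →
        IsPolarizationOfT C D) := by
  obtain ⟨U, hU⟩ := hI.hasSupports
  have hV := hdual.hasSupports hU
  have hA : ∀ a ∈ rowCount v n '' dualSupports U, ∀ i, a i ≤ n i + 1 := by
    rintro _ ⟨F, -, rfl⟩
    exact rowCount_le F
  refine ⟨⟨fun h => h.isCSstar_dual hU hV, fun h => ⟨hU.2.isMultigraded, _,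
    segIdeal_isRadical _, segIdeal_borelFixed _, h.sameHS_segIdeal hU hV⟩⟩, ?_⟩
  intro h τ σ' hτ hσ B C D hB hC hD
  have hstar := h.isCSstar_dual hU hV
  have hBeq := hB.eq_segIdeal hτ hU (hstar.sameHS_segIdeal hU hV)
  refine ⟨rowCount v n '' dualSupports U, hA, hC.eq_span_rowCount hσ hV hstar, ?_⟩
  have hDs := hD.hasSupports (hBeq ▸ hasSupports_segIdeal _)
  rw [dualSupports_dualSupports] at hDs
  exact hDs.congr (hasSupports_pol _)

end
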